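/- arXiv:1902.09005 — 2 statements merged into one kernel-verified Lean document; each statement's English description precedes it below -/
import Mathlib

section
/- Suppose sampling is synchronous, i.e., ε = u/v for positive integers u, v, so that the sampled noise variance σ_ε²[i] is periodic in i with period N_{u,v} = p·v + u. Let Δ_{u,v} be the unique positive solution of (1/N_{u,v})·Σ_{i=0}^{N_{u,v}−1} (Δ_{u,v} − σ_ε²[i])^+ = P. Then the capacity of the channel Y_ε[i] = X[i] + W_ε[i] under the average power constraint P equals C̄_{u,v} = (1/(2·N_{u,v}))·Σ_{i=0}^{N_{u,v}−1} ( log₂( Δ_{u,v} / σ_ε²[i] ) )^+. -/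
open MeasureTheory ProbabilityTheory Filter Topology
open scoped NNReal ENNReal

/-- The law of a block of `l` samples of the memoryless zero-mean Gaussian noise whose
variance at time `i` is `σ2 i`. -/
noncomputable def noiseMeasure (σ2 : ℕ → ℝ) (l : ℕ) : Measure (Fin l → ℝ) :=
  Measure.pi fun i : Fin l => gaussianReal 0 (σ2 (i : ℕ)).toNNReal

/-- The average power constraint `(1/l) ∑ᵢ |x[i]|² ≤ P` on a codeword `x` of blocklength `l`. -/
def powerConstraint (P : ℝ) (l : ℕ) (x : Fin l → ℝ) : Prop :=
  (1 / (l : ℝ)) * ∑ i, (x i) ^ 2 ≤ P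

/-- The average probability of error of a code with `M` equiprobable messages, encoder `enc`
and decoder `dec`, and blocklength `l`, over the memoryless additive Gaussian noise channel
`Y[i] = x[i] + W[i]` with noise variances `σ2`. -/
noncomputable def avgError (σ2 : ℕ → ℝ) (l M : ℕ)
    (enc : Fin M → Fin l → ℝ) (dec : (Fin l → ℝ) → Fin M) : ℝ :=
  (1 / (M : ℝ)) * ∑ u : Fin M,
    ((noiseMeasure σ2 l) {w | dec (fun i => enc u i + w i) ≠ u}).toReal

/-- A rate `R_s` is achievable if, for every `η₁, η₂ > 0` and every sufficiently large
blocklength `l`, there is a code whose (power-constrained) codewords have average error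
probability below `η₁` and rate `log₂(M)/l ≥ R_s − η₂`. -/
def IsAchievableRate (σ2 : ℕ → ℝ) (P R_s : ℝ) : Prop :=
  ∀ η₁ > (0 : ℝ), ∀ η₂ > (0 : ℝ), ∃ l₀ : ℕ, ∀ l > l₀,
    ∃ (M : ℕ) (enc : Fin M → Fin l → ℝ) (dec : (Fin l → ℝ) → Fin M),
      (∀ u, powerConstraint P l (enc u)) ∧
      avgError σ2 l M enc dec < η₁ ∧
      Real.logb 2 (M : ℝ) / (l : ℝ) ≥ R_s - η₂

/-- The capacity of the memoryless additive Gaussian noise channel with noise variances `σ2`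
under the average power constraint `P`: the supremum of all achievable rates. -/
noncomputable def capacity (σ2 : ℕ → ℝ) (P : ℝ) : ℝ :=
  sSup {R : ℝ | IsAchievableRate σ2 P R}

/-- One-letter log-likelihood ratio between `N(x, σ)` and `N(0, s)` at `x + w`. -/
noncomputable def llr1 (σ s x w : ℝ) : ℝ :=
  (1 / 2) * Real.log (s / σ) + (1 / 2) * ((x + w) ^ 2 / s - w ^ 2 / σ)

lemma llr1_pdf (σ s x w : ℝ) (hσ : 0 < σ) (hs : 0 < s) :
    gaussianPDFReal 0 s.toNNReal (x + w) =
      gaussianPDFReal 0 σ.toNNReal w * Real.exp (-llr1 σ s x w) := by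
  have hpi := Real.pi_pos
  simp only [gaussianPDFReal, Real.coe_toNNReal _ hσ.le, Real.coe_toNNReal _ hs.le, llr1, sub_zero]
  have h1 : Real.exp (-((1 / 2) * Real.log (s / σ) + (1 / 2) * ((x + w) ^ 2 / s - w ^ 2 / σ))) =
      (√σ / √s) * Real.exp (-((x+w)^2 / (2 * s))) * Real.exp (w ^ 2 / (2 * σ)) := by
    have : √σ / √s = Real.exp (-(1 / 2 * Real.log (s / σ))) := by
      rw [← Real.sqrt_div hσ.le, Real.sqrt_eq_rpow, Real.rpow_def_of_pos (by positivity),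
        Real.log_div hσ.ne' hs.ne', Real.log_div hs.ne' hσ.ne']
      congr 1; ring
    rw [this, ← Real.exp_add, ← Real.exp_add]
    congr 1
    field_simp
    ring
  rw [h1, Real.sqrt_mul (by positivity) s, Real.sqrt_mul (by positivity) σ]
  have h2 : Real.exp (-w ^ 2 / (2 * σ)) * Real.exp (w ^ 2 / (2 * σ)) = 1 := by
    rw [← Real.exp_add]; simp [neg_div]
  have hσ' : √σ ≠ 0 := (Real.sqrt_pos.2 hσ).ne'
  have hs' : √s ≠ 0 := (Real.sqrt_pos.2 hs).ne'
  have hp' : √(2 * Real.pi) ≠ 0 := (Real.sqrt_pos.2 (by positivity)).ne'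
  rw [neg_div]
  calc _ = ((√(2 * Real.pi))⁻¹ * (√s)⁻¹ * Real.exp (-((x + w) ^ 2 / (2 * s)))) * 1 := by
        rw [mul_inv, mul_one]
    _ = _ := by
        rw [← h2]
        field_simp

lemma measurable_llr1 (σ s x : ℝ) : Measurable (llr1 σ s x) := by
  unfold llr1; fun_prop

lemma change1 (σ s x : ℝ) (hσ : 0 < σ) (hs : 0 < s) (B : Set ℝ) (hB : MeasurableSet B) :
    gaussianReal 0 s.toNNReal B =
      ∫⁻ w in {w | x + w ∈ B}, ENNReal.ofReal (Real.exp (-llr1 σ s x w))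
        ∂gaussianReal 0 σ.toNNReal := by
  have hs' : s.toNNReal ≠ 0 := by simpa using hs
  have hσ' : σ.toNNReal ≠ 0 := by simpa using hσ
  have hm := measurable_llr1 σ s x
  have hB' : MeasurableSet {w | x + w ∈ B} := (measurable_const_add x) hB
  rw [gaussianReal_apply 0 hs', ← lintegral_indicator hB, ← lintegral_add_left_eq_self _ x,
    ← lintegral_indicator hB', gaussianReal_of_var_ne_zero 0 hσ',
    lintegral_withDensity_eq_lintegral_mul _ (measurable_gaussianPDF _ _)
      (Measurable.indicator (by fun_prop) hB')]
  congr 1 with w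
  by_cases h : x + w ∈ B
  · simp only [Set.indicator, h, if_true, Pi.mul_apply, Set.mem_ofPred_eq, gaussianPDF]
    rw [llr1_pdf σ s x w hσ hs, ENNReal.ofReal_mul (gaussianPDFReal_nonneg _ _ _)]
  · simp [Set.indicator, h]

instance instProbNoise (τ : ℕ → ℝ) (l : ℕ) : IsProbabilityMeasure (noiseMeasure τ l) := by
  unfold noiseMeasure; infer_instance

/-- Blockwise log-likelihood ratio. -/
noncomputable def bllr (σ s : ℕ → ℝ) (l : ℕ) (x w : Fin l → ℝ) : ℝ :=
  ∑ i : Fin l, llr1 (σ i) (s i) (x i) (w i)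

lemma measurable_bllr (σ s : ℕ → ℝ) (l : ℕ) (x : Fin l → ℝ) : Measurable (bllr σ s l x) := by
  unfold bllr
  exact Finset.measurable_sum _ fun i _ => (measurable_llr1 _ _ _).comp (measurable_pi_apply i)

lemma change (σ s : ℕ → ℝ) (hσ : ∀ i, 0 < σ i) (hs : ∀ i, 0 < s i) (l : ℕ) (x : Fin l → ℝ)
    (A : Set (Fin l → ℝ)) (hA : MeasurableSet A) :
    noiseMeasure s l A =
      ∫⁻ w in {w | x + w ∈ A}, ENNReal.ofReal (Real.exp (-bllr σ s l x w)) ∂noiseMeasure σ l := by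
  have hm := measurable_bllr σ s l x
  set ν := ((noiseMeasure σ l).withDensity
    (fun w => ENNReal.ofReal (Real.exp (-bllr σ s l x w)))).map (fun w => x + w) with hν
  have hν' : ∀ A, MeasurableSet A → ν A =
      ∫⁻ w in {w | x + w ∈ A}, ENNReal.ofReal (Real.exp (-bllr σ s l x w)) ∂noiseMeasure σ l := by
    intro A hA
    rw [hν, Measure.map_apply (measurable_const_add x) hA, withDensity_apply]
    · rfl
    · exact (measurable_const_add x) hA
  rw [← hν' A hA]
  congr 1
  refine Measure.pi_eq fun B hB => ?_
  rw [hν' _ (MeasurableSet.univ_pi hB), ← lintegral_indicator]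
  swap
  · exact (measurable_const_add x) (MeasurableSet.univ_pi hB)
  let f : Fin l → ℝ → ℝ≥0∞ := fun i => Set.indicator {w | x i + w ∈ B i}
    (fun w => ENNReal.ofReal (Real.exp (-llr1 (σ i) (s i) (x i) w)))
  have hf : ∀ i, Measurable (f i) := fun i => by
    have := measurable_llr1 (σ i) (s i) (x i)
    exact Measurable.indicator (by fun_prop) ((measurable_const_add (x i)) (hB i))
  have key : ∀ w : Fin l → ℝ, Set.indicator {w | x + w ∈ Set.univ.pi B}
      (fun w => ENNReal.ofReal (Real.exp (-bllr σ s l x w))) w =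
      ∏ i, (fun (i : Fin l) (w : Fin l → ℝ) => f i (w i)) i w := by
    intro w
    by_cases h : x + w ∈ Set.univ.pi B
    · have h' : ∀ i, x i + w i ∈ B i := by simpa [Set.mem_pi] using h
      simp only [Set.indicator, h, Set.mem_ofPred_eq, if_true, f, h', bllr]
      rw [← Finset.sum_neg_distrib, Real.exp_sum, ENNReal.ofReal_prod_of_nonneg]
      intro i _; positivity
    · have h' : ∃ i, x i + w i ∉ B i := by simpa [Set.mem_pi] using h
      obtain ⟨i, hi⟩ := h'
      have : w ∉ {w | x + w ∈ Set.univ.pi B} := h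
      rw [Set.indicator_of_notMem this, eq_comm]
      apply Finset.prod_eq_zero (Finset.mem_univ i)
      simp [f, hi]
  simp_rw [key]
  rw [lintegral_prod_eq_prod_lintegral_of_indepFun]
  · refine Finset.prod_congr rfl fun i _ => ?_
    rw [change1 (σ i) (s i) (x i) (hσ i) (hs i) (B i) (hB i), ← lintegral_indicator]
    swap
    · exact (measurable_const_add (x i)) (hB i)
    exact (measurePreserving_eval (fun i : Fin l => gaussianReal 0 (σ (i : ℕ)).toNNReal)
      i).lintegral_comp (hf i)
  · exact iIndepFun_pi (fun i => (hf i).aemeasurable)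
  · exact fun i => (hf i).comp (measurable_pi_apply i)

lemma noise_add (S σ : ℕ → ℝ) (hS : ∀ i, 0 ≤ S i) (hσ : ∀ i, 0 ≤ σ i) (l : ℕ) :
    ((noiseMeasure S l).prod (noiseMeasure σ l)).map (fun z => z.1 + z.2) =
      noiseMeasure (fun i => S i + σ i) l := by
  have h := measurePreserving_arrowProdEquivProdArrow ℝ ℝ (Fin l)
    (fun i => gaussianReal 0 (S (i : ℕ)).toNNReal) (fun i => gaussianReal 0 (σ (i : ℕ)).toNNReal)
  unfold noiseMeasure
  rw [← h.map_eq, Measure.map_map (by fun_prop) h.measurable]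
  have e : ((fun z : (Fin l → ℝ) × (Fin l → ℝ) => z.1 + z.2) ∘
      (MeasurableEquiv.arrowProdEquivProdArrow ℝ ℝ (Fin l))) =
      fun z i => (fun (_ : Fin l) (z : ℝ × ℝ) => z.1 + z.2) i (z i) := by
    ext z i; rfl
  have h1 : ∀ i : ℕ, ((gaussianReal 0 (S i).toNNReal).prod (gaussianReal 0 (σ i).toNNReal)).map
      (fun z : ℝ × ℝ => z.1 + z.2) = gaussianReal 0 (S i + σ i).toNNReal := by
    intro i
    have := gaussianReal_conv_gaussianReal (m₁ := 0) (m₂ := 0) (v₁ := (S i).toNNReal)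
      (v₂ := (σ i).toNNReal)
    rw [Real.toNNReal_add (hS i) (hσ i)]
    simpa [Measure.conv] using this
  have : ∀ i : Fin l, SigmaFinite (Measure.map (fun z : ℝ × ℝ => z.1 + z.2)
    ((gaussianReal 0 (S (i : ℕ)).toNNReal).prod (gaussianReal 0 (σ (i : ℕ)).toNNReal))) := by
    intro i; rw [h1]; infer_instance
  rw [e, Measure.pi_map_pi (f := fun (_ : Fin l) (z : ℝ × ℝ) => z.1 + z.2)
    (μ := fun i : Fin l => (gaussianReal 0 (S (i : ℕ)).toNNReal).prod
      (gaussianReal 0 (σ (i : ℕ)).toNNReal)) (fun i => by fun_prop)]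
  simp_rw [h1]

/-- Variance of the square of a standard Gaussian. -/
noncomputable def KK : ℝ := Var[fun x => x ^ 2; gaussianReal 0 1]

lemma KK_nonneg : 0 ≤ KK := variance_nonneg _ _

lemma memLp_sq (v : ℝ≥0) : MemLp (fun x : ℝ => x ^ 2) 2 (gaussianReal 0 v) := by
  have h := memLp_id_gaussianReal' (μ := 0) (v := v) 4 (by norm_num)
  have := h.norm_rpow_div (q := 2)
  have e : (4 : ℝ≥0∞) / 2 = 2 := by
    rw [show (4 : ℝ≥0∞) = 2 * 2 by norm_num]
    exact ENNReal.mul_div_cancel_right (by norm_num) (by norm_num)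
  rw [e] at this
  simpa using this

lemma var_sq (τ : ℝ) (hτ : 0 ≤ τ) : Var[fun x => x ^ 2; gaussianReal 0 τ.toNNReal] = τ ^ 2 * KK := by
  have h := gaussianReal_map_const_mul (μ := 0) (v := 1) (√τ)
  have e : gaussianReal 0 τ.toNNReal = (gaussianReal 0 1).map (fun x => √τ * x) := by
    rw [h]
    congr 1
    · simp
    · ext; simp [hτ]
  rw [e, variance_map (by fun_prop) (by fun_prop)]
  have : ((fun x : ℝ => x ^ 2) ∘ fun x => √τ * x) = fun x => τ * x ^ 2 := by
    ext x; simp [mul_pow, hτ]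
  rw [this, variance_const_mul, KK]

lemma mean_sq (τ : ℝ) (hτ : 0 ≤ τ) : ∫ x, x ^ 2 ∂gaussianReal 0 τ.toNNReal = τ := by
  have h := variance_fun_id_gaussianReal (μ := 0) (v := τ.toNNReal)
  rw [variance_of_integral_eq_zero (by fun_prop) (by simp)] at h
  rw [h]; simp [hτ]

lemma cheb (τ a : ℕ → ℝ) (hτ : ∀ i, 0 ≤ τ i) (l : ℕ) (t V : ℝ) (ht : 0 < t)
    (hV : ∀ i, (a i * τ i) ^ 2 ≤ V) :
    noiseMeasure τ l {w | t ≤ |∑ i : Fin l, a i * ((w i) ^ 2 - τ i)|} ≤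
      ENNReal.ofReal (l * V * KK / t ^ 2) := by
  have hm : ∀ i : Fin l, MemLp (fun x : ℝ => a i * x ^ 2) 2 (gaussianReal 0 (τ i).toNNReal) :=
    fun i => (memLp_sq _).const_mul _
  have hm' : ∀ i : Fin l, MemLp (fun w : Fin l → ℝ => a i * (w i) ^ 2) 2 (noiseMeasure τ l) :=
    fun i => (hm i).comp_measurePreserving
      (measurePreserving_eval (fun i : Fin l => gaussianReal 0 (τ (i : ℕ)).toNNReal) i)
  have hms : MemLp (∑ i : Fin l, fun w : Fin l → ℝ => a i * (w i) ^ 2) 2 (noiseMeasure τ l) :=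
    memLp_finsetSum' _ fun i _ => hm' i
  have hmean : ∫ w, (∑ i : Fin l, fun w : Fin l → ℝ => a i * (w i) ^ 2) w ∂(noiseMeasure τ l) =
      ∑ i : Fin l, a i * τ i := by
    simp only [Finset.sum_apply]
    rw [integral_finsetSum _ (fun i _ => (hm' i).integrable (by norm_num))]
    refine Finset.sum_congr rfl fun i _ => ?_
    unfold noiseMeasure
    rw [integral_comp_eval (f := fun x : ℝ => a i * x ^ 2)
      (μ := fun i : Fin l => gaussianReal 0 (τ (i : ℕ)).toNNReal) (hm i).1,
      integral_const_mul, mean_sq _ (hτ i)]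
  have hvar : Var[∑ i : Fin l, fun w : Fin l → ℝ => a i * (w i) ^ 2; noiseMeasure τ l] ≤
      l * V * KK := by
    unfold noiseMeasure
    rw [variance_sum_pi hm]
    calc _ ≤ ∑ i : Fin l, V * KK := Finset.sum_le_sum fun i _ => by
          rw [variance_const_mul, var_sq _ (hτ i), ← mul_assoc, ← mul_pow]
          exact mul_le_mul_of_nonneg_right (hV i) KK_nonneg
      _ = _ := by simp [mul_assoc]
  have := meas_ge_le_variance_div_sq hms ht
  rw [hmean] at this
  refine le_trans (le_of_eq ?_) (this.trans (ENNReal.ofReal_le_ofReal ?_))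
  · congr 1; ext w
    simp [mul_sub]
  · gcongr

lemma feinstein {l : ℕ} (μ W : Measure (Fin l → ℝ)) [IsProbabilityMeasure μ]
    [IsProbabilityMeasure W] (B : Set ((Fin l → ℝ) × (Fin l → ℝ))) (hB : MeasurableSet B)
    (F : Set (Fin l → ℝ)) (hF : MeasurableSet F) (β ε : ℝ≥0∞) (M : ℕ)
    (hQ : ∀ x, ((μ.prod W).map fun z => z.1 + z.2) {y | (x, y) ∈ B} ≤ β)
    (h : (μ.prod W) {z | (z.1, z.1 + z.2) ∉ B} + M * β < ε * μ F) :
    ∀ m ≤ M, ∃ (enc : ℕ → Fin l → ℝ) (D : ℕ → Set (Fin l → ℝ)),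
      ∀ u < m, enc u ∈ F ∧ MeasurableSet (D u) ∧ (∀ u' < u, Disjoint (D u') (D u)) ∧
        D u ⊆ {y | (enc u, y) ∈ B} ∧ W {w | enc u + w ∉ D u} ≤ ε := by
  intro m
  induction m with
  | zero => intro _; exact ⟨0, fun _ => ∅, fun u hu => absurd hu (Nat.not_lt_zero u)⟩
  | succ m ih =>
    intro hm
    obtain ⟨enc, D, hD⟩ := ih (by omega)
    set U : Set (Fin l → ℝ) := ⋃ u ∈ Finset.range m, D u with hU
    have hUm : MeasurableSet U := by
      refine Finset.measurableSet_biUnion _ fun u hu => (hD u (Finset.mem_range.1 hu)).2.1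
    have hsect : ∀ x, MeasurableSet {y | (x, y) ∈ B} := fun x => measurable_prodMk_left hB
    have hQU : ((μ.prod W).map fun z => z.1 + z.2) U ≤ M * β := by
      calc _ ≤ ∑ u ∈ Finset.range m, ((μ.prod W).map fun z => z.1 + z.2) (D u) :=
            measure_biUnion_finset_le _ _
        _ ≤ ∑ u ∈ Finset.range m, β := Finset.sum_le_sum fun u hu =>
            (measure_mono (hD u (Finset.mem_range.1 hu)).2.2.2.1).trans (hQ _)
        _ = m * β := by simp
        _ ≤ M * β := by gcongr; omega
    have hadd : Measurable (fun z : (Fin l → ℝ) × (Fin l → ℝ) => z.1 + z.2) := by fun_prop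
    have hJ : MeasurableSet {z : (Fin l → ℝ) × (Fin l → ℝ) | (z.1, z.1 + z.2) ∉ B} :=
      ((measurable_fst.prodMk hadd) hB).compl
    have hV : MeasurableSet {z : (Fin l → ℝ) × (Fin l → ℝ) | z.1 + z.2 ∈ U} := hadd hUm
    obtain ⟨x, hxF, hx⟩ : ∃ x ∈ F, W {w | x + w ∉ {y | (x, y) ∈ B} \ U} ≤ ε := by
      by_contra! hcon
      have h1 : ε * μ F ≤ ∫⁻ x in F, (W {w | (x, x + w) ∉ B} + W {w | x + w ∈ U}) ∂μ := by
        rw [← setLIntegral_const]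
        refine setLIntegral_mono' hF fun x hx => ?_
        refine (hcon x hx).le.trans (le_trans (measure_mono ?_) (measure_union_le _ _))
        intro w hw
        by_cases hxB : (x, x + w) ∈ B
        · right
          by_contra hxU
          exact hw ⟨hxB, hxU⟩
        · left; exact hxB
      have h2 : ∫⁻ x in F, (W {w | (x, x + w) ∉ B} + W {w | x + w ∈ U}) ∂μ ≤
          (μ.prod W) {z | (z.1, z.1 + z.2) ∉ B} + M * β := by
        refine (setLIntegral_le_lintegral _ _).trans ?_
        rw [lintegral_add_left]
        · refine add_le_add ?_ ?_
          · rw [Measure.prod_apply hJ]; rfl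
          · rw [Measure.map_apply hadd hUm, Measure.prod_apply (hadd hUm)] at hQU
            exact hQU
        · exact measurable_measure_prodMk_left hJ
      exact absurd h (not_lt.2 (h1.trans h2))
    refine ⟨Function.update enc m x, Function.update D m ({y | (x, y) ∈ B} \ U), ?_⟩
    intro u hu
    rcases Nat.lt_succ_iff_lt_or_eq.1 hu with hlt | rfl
    · have hne : u ≠ m := hlt.ne
      obtain ⟨a1, a2, a3, a4, a5⟩ := hD u hlt
      simp only [Function.update_of_ne hne]
      refine ⟨a1, a2, fun u' hu' => ?_, a4, a5⟩
      rw [Function.update_of_ne (by omega)]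
      exact a3 u' hu'
    · simp only [Function.update_self]
      refine ⟨hxF, (hsect x).diff hUm, fun u' hu' => ?_, Set.sdiff_subset, hx⟩
      rw [Function.update_of_ne (by omega)]
      rw [Set.disjoint_left]
      intro y hy hy'
      apply hy'.2
      simp only [hU, Set.mem_iUnion, Finset.mem_range]
      exact ⟨u', hu', hy⟩

lemma code_of_feinstein (σ : ℕ → ℝ) (P : ℝ) (l M : ℕ) (hM : 0 < M) (ε : ℝ) (hε : 0 ≤ ε)
    (enc : ℕ → Fin l → ℝ) (D : ℕ → Set (Fin l → ℝ))
    (h : ∀ u < M, enc u ∈ {x | powerConstraint P l x} ∧ (∀ u' < u, Disjoint (D u') (D u)) ∧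
        noiseMeasure σ l {w | enc u + w ∉ D u} ≤ ENNReal.ofReal ε) :
    ∃ (enc : Fin M → Fin l → ℝ) (dec : (Fin l → ℝ) → Fin M),
      (∀ u, powerConstraint P l (enc u)) ∧ avgError σ l M enc dec ≤ ε := by
  classical
  refine ⟨fun u => enc u, fun y => if hy : ∃ u : Fin M, y ∈ D u then hy.choose else ⟨0, hM⟩,
    fun u => (h u u.2).1, ?_⟩
  have hM' : (0 : ℝ) < M := by exact_mod_cast hM
  unfold avgError
  rw [one_div, inv_mul_le_iff₀ hM']
  calc _ ≤ ∑ u : Fin M, ε := Finset.sum_le_sum fun u _ => ?_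
    _ = _ := by simp
  refine ENNReal.toReal_le_of_le_ofReal hε (le_trans (measure_mono ?_) (h u u.2).2.2)
  intro w hw hmem
  apply hw
  have hy : ∃ v : Fin M, (fun i => enc u i + w i) ∈ D v := ⟨u, hmem⟩
  show (if hy : ∃ v : Fin M, (fun i => enc u i + w i) ∈ D v then hy.choose else ⟨0, hM⟩) = u
  rw [dif_pos hy]
  have hc := hy.choose_spec
  by_contra hne
  rcases lt_or_gt_of_ne (fun e => hne (Fin.ext e) : (hy.choose : ℕ) ≠ u) with h1 | h1
  · exact Set.disjoint_left.1 ((h u u.2).2.1 _ h1) hc hmem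
  · exact Set.disjoint_left.1 ((h _ hy.choose.2).2.1 _ h1) hmem hc

/-- One-shot achievability. -/
lemma oneshot_ach (σ S : ℕ → ℝ) (hσ : ∀ i, 0 < σ i) (hS : ∀ i, 0 ≤ S i) (Δ : ℝ)
    (hSΔ : ∀ i, S i ≤ Δ) (P : ℝ) (l M : ℕ) (hl : 0 < l)
    (hM : 0 < M) (ε δ t : ℝ) (hε : 0 ≤ ε) (hδ : 0 < δ) (ht : 0 < t)
    (hpow : ∑ i : Fin l, S i + t ≤ l * P)
    (hF : l * Δ ^ 2 * KK / t ^ 2 ≤ 1 / 2)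
    (hmain : 2 * (l * KK / (l * δ) ^ 2) +
      M * Real.exp (l * δ - ∑ i : Fin l, (1 / 2) * Real.log ((S i + σ i) / σ i)) < ε * (1 / 2)) :
    ∃ (enc : Fin M → Fin l → ℝ) (dec : (Fin l → ℝ) → Fin M),
      (∀ u, powerConstraint P l (enc u)) ∧ avgError σ l M enc dec ≤ ε := by
  have hl' : (0 : ℝ) < l := by exact_mod_cast hl
  set s : ℕ → ℝ := fun i => S i + σ i with hs
  have hspos : ∀ i, 0 < s i := fun i => add_pos_of_nonneg_of_pos (hS i) (hσ i)
  set B : Set ((Fin l → ℝ) × (Fin l → ℝ)) := {z | -(2 * (l * δ)) <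
    ∑ i : Fin l, ((z.2 i) ^ 2 / s i - (z.2 i - z.1 i) ^ 2 / σ i)} with hBdef
  have hB : MeasurableSet B := measurableSet_lt (by fun_prop) (by fun_prop)
  set β : ℝ := Real.exp (l * δ - ∑ i : Fin l, (1 / 2) * Real.log (s i / σ i)) with hβ
  set F : Set (Fin l → ℝ) := {x | powerConstraint P l x} with hFdef
  have hFm : MeasurableSet F := by
    unfold powerConstraint at hFdef
    exact measurableSet_le (by fun_prop) (by fun_prop)
  have hconv := noise_add S σ hS (fun i => (hσ i).le) l
  have hadd : Measurable (fun z : (Fin l → ℝ) × (Fin l → ℝ) => z.1 + z.2) := by fun_prop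
  -- the output probability of decoding sets
  have hQ : ∀ x, (((noiseMeasure S l).prod (noiseMeasure σ l)).map fun z => z.1 + z.2)
      {y | (x, y) ∈ B} ≤ ENNReal.ofReal β := by
    intro x
    have hsect : MeasurableSet {y | (x, y) ∈ B} := measurable_prodMk_left hB
    rw [hconv, change σ s hσ hspos l x _ hsect]
    calc _ ≤ ∫⁻ w in {w | x + w ∈ {y | (x, y) ∈ B}}, ENNReal.ofReal β ∂noiseMeasure σ l := by
          refine setLIntegral_mono' ((measurable_const_add x) hsect) fun w hw => ?_
          refine ENNReal.ofReal_le_ofReal (Real.exp_le_exp.2 ?_)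
          have hw' : -(2 * (l * δ)) < ∑ i : Fin l, ((x i + w i) ^ 2 / s i - (w i) ^ 2 / σ i) := by
            have := hw
            simp only [Set.mem_ofPred_eq, hBdef, Pi.add_apply, add_sub_cancel_left] at this
            exact this
          simp only [bllr, llr1, Finset.sum_add_distrib]
          rw [← Finset.mul_sum (f := fun i : Fin l => ((x i + w i) ^ 2 / s i - (w i) ^ 2 / σ i))]
          linarith
      _ ≤ ENNReal.ofReal β := by
          rw [setLIntegral_const]
          exact mul_le_of_le_one_right' prob_le_one
  -- atypical pairs
  have hJ : ((noiseMeasure S l).prod (noiseMeasure σ l)) {z | (z.1, z.1 + z.2) ∉ B} ≤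
      ENNReal.ofReal (2 * (l * KK / (l * δ) ^ 2)) := by
    have c1 := cheb s (fun i => 1 / s i) (fun i => (hspos i).le) l (l * δ) 1 (by positivity)
      (fun i => by have := (hspos i).ne'; simp [this])
    have c2 := cheb σ (fun i => 1 / σ i) (fun i => (hσ i).le) l (l * δ) 1 (by positivity)
      (fun i => by have := (hσ i).ne'; simp [this])
    have m1 : MeasurableSet {w : Fin l → ℝ | l * δ ≤ |∑ i : Fin l, 1 / s i * ((w i) ^ 2 - s i)|} :=
      measurableSet_le (by fun_prop) (by fun_prop)
    have m2 : MeasurableSet {w : Fin l → ℝ | l * δ ≤ |∑ i : Fin l, 1 / σ i * ((w i) ^ 2 - σ i)|} :=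
      measurableSet_le (by fun_prop) (by fun_prop)
    rw [← hconv, Measure.map_apply hadd m1] at c1
    rw [← Measure.snd_prod (μ := noiseMeasure S l) (ν := noiseMeasure σ l), Measure.snd_apply m2]
      at c2
    have hKK := KK_nonneg
    rw [two_mul, ENNReal.ofReal_add (by positivity) (by positivity)]
    refine le_trans (measure_mono ?_) ((measure_union_le _ _).trans
      (add_le_add (c1.trans ?_) (c2.trans ?_)))
    · intro z hz
      have hz' : ∑ i : Fin l, ((z.1 i + z.2 i) ^ 2 / s i - (z.2 i) ^ 2 / σ i) ≤
          -(2 * (l * δ)) := by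
        have := hz
        simp only [Set.mem_ofPred_eq, hBdef, Pi.add_apply, add_sub_cancel_left, not_lt] at this
        exact this
      have e : ∑ i : Fin l, ((z.1 i + z.2 i) ^ 2 / s i - (z.2 i) ^ 2 / σ i) =
          ∑ i : Fin l, 1 / s i * ((z.1 i + z.2 i) ^ 2 - s i) -
          ∑ i : Fin l, 1 / σ i * ((z.2 i) ^ 2 - σ i) := by
        rw [← Finset.sum_sub_distrib]
        refine Finset.sum_congr rfl fun i _ => ?_
        have := (hspos i).ne'
        have := (hσ i).ne'
        field_simp
        ring
      rw [e] at hz'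
      simp only [Set.mem_union, Set.mem_preimage, Set.mem_ofPred_eq, Pi.add_apply]
      by_contra! hcon
      have h1 := (abs_lt.1 hcon.1).1
      have h2 := (abs_lt.1 hcon.2).2
      linarith
    · simp
    · simp
  -- power
  have hFp : ENNReal.ofReal (1 / 2) ≤ noiseMeasure S l F := by
    have c := cheb S (fun _ => 1) hS l t (Δ ^ 2) ht (fun i => by
      have h1 := hS i; have h2 := hSΔ i; rw [one_mul]; gcongr)
    have c' : noiseMeasure S l Fᶜ ≤ ENNReal.ofReal (1 / 2) := by
      refine le_trans (measure_mono ?_) (c.trans (ENNReal.ofReal_le_ofReal hF))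
      intro x hx
      have hx' : P < 1 / (l : ℝ) * ∑ i, (x i) ^ 2 := not_le.1 hx
      rw [one_div, lt_inv_mul_iff₀ hl'] at hx'
      simp only [Set.mem_ofPred_eq, one_mul, Finset.sum_sub_distrib]
      refine le_trans ?_ (le_abs_self _)
      linarith
    have := prob_compl_eq_one_sub (μ := noiseMeasure S l) hFm.compl
    rw [compl_compl] at this
    rw [this]
    refine ENNReal.le_sub_of_add_le_left (by finiteness) ?_
    calc _ ≤ ENNReal.ofReal (1 / 2) + ENNReal.ofReal (1 / 2) := by gcongr
      _ = 1 := by rw [← ENNReal.ofReal_add] <;> norm_num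
  have hβ0 : 0 ≤ β := (Real.exp_pos _).le
  have hKK := KK_nonneg
  obtain ⟨enc, D, hD⟩ := feinstein (noiseMeasure S l) (noiseMeasure σ l) B hB F hFm
    (ENNReal.ofReal β) (ENNReal.ofReal ε) M hQ (by
      calc _ ≤ ENNReal.ofReal (2 * (l * KK / (l * δ) ^ 2)) + ENNReal.ofReal (M * β) := by
            rw [ENNReal.ofReal_mul (p := (M : ℝ)) (by positivity)]
            simp only [ENNReal.ofReal_natCast]
            gcongr
        _ = ENNReal.ofReal (2 * (l * KK / (l * δ) ^ 2) + M * β) :=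
            (ENNReal.ofReal_add (by positivity) (by positivity)).symm
        _ < ENNReal.ofReal (ε * (1 / 2)) :=
            (ENNReal.ofReal_lt_ofReal_iff_of_nonneg (by positivity)).2 hmain
        _ ≤ _ := by
            rw [ENNReal.ofReal_mul hε]
            gcongr) M le_rfl
  exact code_of_feinstein σ P l M hM ε hε enc D fun u hu =>
    ⟨(hD u hu).1, (hD u hu).2.2.1, (hD u hu).2.2.2.2⟩

lemma integrable_llr1 (σ s x : ℝ) (v : ℝ≥0) : Integrable (llr1 σ s x) (gaussianReal 0 v) := by
  have h2 : Integrable (fun w : ℝ => w ^ 2) (gaussianReal 0 v) :=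
    (memLp_sq v).integrable (by norm_num)
  have h1 : Integrable (fun w : ℝ => w) (gaussianReal 0 v) :=
    (memLp_id_gaussianReal' (μ := 0) (v := v) 1 (by norm_num)).integrable (by norm_num)
  have e : llr1 σ s x = fun w => (1 / 2 * Real.log (s / σ) + 1 / 2 * (x ^ 2 / s)) +
      ((x / s) * w + (1 / 2 * (1 / s - 1 / σ)) * w ^ 2) := by
    ext w; unfold llr1; ring
  rw [e]
  exact (integrable_const _).add ((h1.const_mul _).add (h2.const_mul _))

lemma integral_llr1 (σ s x : ℝ) (hσ : 0 < σ) : ∫ w, llr1 σ s x w ∂gaussianReal 0 σ.toNNReal =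
    1 / 2 * Real.log (s / σ) + 1 / 2 * ((x ^ 2 + σ) / s - 1) := by
  have h2 : Integrable (fun w : ℝ => w ^ 2) (gaussianReal 0 σ.toNNReal) :=
    (memLp_sq _).integrable (by norm_num)
  have h1 : Integrable (fun w : ℝ => w) (gaussianReal 0 σ.toNNReal) :=
    (memLp_id_gaussianReal' (μ := 0) 1 (by norm_num)).integrable (by norm_num)
  have e : llr1 σ s x = fun w => (1 / 2 * Real.log (s / σ) + 1 / 2 * (x ^ 2 / s)) +
      ((x / s) * w + (1 / 2 * (1 / s - 1 / σ)) * w ^ 2) := by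
    ext w; unfold llr1; ring
  have h3 : Integrable (fun w : ℝ => (x / s) * w + (1 / 2 * (1 / s - 1 / σ)) * w ^ 2)
    (gaussianReal 0 σ.toNNReal) := (h1.const_mul _).add (h2.const_mul _)
  rw [e]
  beta_reduce
  rw [integral_add (integrable_const _) h3,
    integral_add (h1.const_mul _) (h2.const_mul _), integral_const_mul, integral_const_mul,
    mean_sq _ hσ.le, integral_id_gaussianReal]
  simp only [integral_const, probReal_univ, one_smul]
  field_simp
  ring

lemma integrable_bllr (σ s : ℕ → ℝ) (l : ℕ) (x : Fin l → ℝ) :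
    Integrable (bllr σ s l x) (noiseMeasure σ l) := by
  unfold bllr noiseMeasure
  exact integrable_finsetSum _ fun i _ => integrable_comp_eval (integrable_llr1 _ _ _ _)

lemma integral_bllr (σ s : ℕ → ℝ) (hσ : ∀ i, 0 < σ i) (l : ℕ) (x : Fin l → ℝ) :
    ∫ w, bllr σ s l x w ∂noiseMeasure σ l =
      ∑ i : Fin l, (1 / 2 * Real.log (s i / σ i) + 1 / 2 * (((x i) ^ 2 + σ i) / s i - 1)) := by
  unfold bllr noiseMeasure
  rw [integral_finsetSum _ fun i _ => integrable_comp_eval (integrable_llr1 _ _ _ _)]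
  refine Finset.sum_congr rfl fun i _ => ?_
  rw [integral_comp_eval (integrable_llr1 _ _ _ _).1, integral_llr1 _ _ _ (hσ i)]

lemma conv_msg (σ s : ℕ → ℝ) (hσ : ∀ i, 0 < σ i) (hs : ∀ i, 0 < s i) (l M : ℕ) (hM : 0 < M)
    (x : Fin l → ℝ) (D : Set (Fin l → ℝ)) (hD : MeasurableSet D) :
    (noiseMeasure σ l).real {w | x + w ∈ D} * Real.log M ≤
      ∑ i : Fin l, (1 / 2 * Real.log (s i / σ i) + 1 / 2 * (((x i) ^ 2 + σ i) / s i - 1)) +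
      M * (noiseMeasure s l).real D := by
  rw [← integral_bllr σ s hσ]
  set W := noiseMeasure σ l
  set G : Set (Fin l → ℝ) := {w | x + w ∈ D} with hG
  have hGm : MeasurableSet G := (measurable_const_add x) hD
  have hLm := measurable_bllr σ s l x
  have hM' : (0 : ℝ) < M := by exact_mod_cast hM
  have hLi := integrable_bllr σ s l x
  have hE : ∀ A : Set (Fin l → ℝ), MeasurableSet A →
      IntegrableOn (fun w => Real.exp (-bllr σ s l x w)) {w | x + w ∈ A} W ∧
      ∫ w in {w | x + w ∈ A}, Real.exp (-bllr σ s l x w) ∂W = (noiseMeasure s l).real A := by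
    intro A hA
    have hc := change σ s hσ hs l x A hA
    constructor
    · refine ⟨by fun_prop, ?_⟩
      rw [hasFiniteIntegral_iff_ofReal (Eventually.of_forall fun w => (Real.exp_pos _).le), ← hc]
      exact measure_lt_top _ _
    · rw [integral_eq_lintegral_of_nonneg_ae (Eventually.of_forall fun w => (Real.exp_pos _).le)
        (by fun_prop), ← hc]; rfl
  obtain ⟨i1, e1⟩ := hE Set.univ MeasurableSet.univ
  obtain ⟨i2, e2⟩ := hE D hD
  simp only [Set.mem_univ] at i1 e1
  have eu : {w : Fin l → ℝ | True} = Set.univ := by ext; simp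
  rw [eu] at i1 e1
  rw [integrableOn_univ] at i1
  rw [setIntegral_univ] at e1
  simp only [probReal_univ] at e1
  have i2' : Integrable (G.indicator (fun w => Real.exp (-bllr σ s l x w))) W :=
    i2.integrable_indicator hGm
  have e2' : ∫ w, G.indicator (fun w => Real.exp (-bllr σ s l x w)) w ∂W =
    (noiseMeasure s l).real D := by rw [integral_indicator hGm]; exact e2
  have i3 : Integrable (G.indicator (fun _ => Real.log M)) W :=
    (integrable_const _).indicator hGm
  have key : ∫ w, (G.indicator (fun _ => Real.log M) w + 1) ∂W ≤
      ∫ w, (bllr σ s l x w + (M * G.indicator (fun w => Real.exp (-bllr σ s l x w)) w +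
        Real.exp (-bllr σ s l x w))) ∂W := by
    refine integral_mono (i3.add (integrable_const _)) (hLi.add ((i2'.const_mul _).add i1)) ?_
    intro w
    by_cases hw : w ∈ G
    · simp only [Set.indicator_of_mem hw]
      have h1 := Real.add_one_le_exp (Real.log M - bllr σ s l x w)
      rw [sub_eq_add_neg, Real.exp_add, Real.exp_log hM'] at h1
      have := Real.exp_pos (-bllr σ s l x w)
      linarith
    · simp only [Set.indicator_of_notMem hw]
      have h1 := Real.add_one_le_exp (- bllr σ s l x w)
      linarith
  have i4 : Integrable (fun w => M * G.indicator (fun w => Real.exp (-bllr σ s l x w)) w +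
        Real.exp (-bllr σ s l x w)) W := (i2'.const_mul _).add i1
  rw [integral_add i3 (integrable_const _), integral_add hLi i4,
    integral_add (i2'.const_mul _) i1, integral_const_mul, e1, e2', integral_indicator hGm,
    setIntegral_const] at key
  simp only [integral_const, probReal_univ, smul_eq_mul, one_mul] at key
  linarith

lemma oneshot_conv (σ s : ℕ → ℝ) (hσ : ∀ i, 0 < σ i) (hs : ∀ i, 0 < s i) (l M : ℕ)
    (enc : Fin M → Fin l → ℝ) (dec : (Fin l → ℝ) → Fin M) (A : ℝ)
    (hA : ∀ u, ∑ i : Fin l, (1 / 2 * Real.log (s i / σ i) +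
      1 / 2 * (((enc u i) ^ 2 + σ i) / s i - 1)) ≤ A) :
    (1 - avgError σ l M enc dec) * Real.log M ≤ A + 1 := by
  have hM : 0 < M := (dec 0).pos
  have hM' : (0 : ℝ) < M := by exact_mod_cast hM
  set W := noiseMeasure σ l
  let E : Fin M → Set (Fin l → ℝ) := fun u => {w | dec (fun i => enc u i + w i) ≠ u}
  let H : Fin M → Set (Fin l → ℝ) := fun u => (toMeasurable W (E u))ᶜ
  let D : Fin M → Set (Fin l → ℝ) := fun u => {y | -enc u + y ∈ H u}
  have hH : ∀ u, MeasurableSet (H u) := fun u => (measurableSet_toMeasurable _ _).compl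
  have hD : ∀ u, MeasurableSet (D u) := fun u => (measurable_const_add (-enc u)) (hH u)
  have hDH : ∀ u, {w | enc u + w ∈ D u} = H u := by
    intro u; ext w; simp [D]
  have hDdec : ∀ u, ∀ y ∈ D u, dec y = u := by
    intro u y hy
    by_contra hne
    apply hy
    apply subset_toMeasurable
    show dec (fun i => enc u i + (-enc u + y) i) ≠ u
    convert hne using 2
    ext i; simp
  have hdisj : Pairwise (Function.onFun Disjoint D) := by
    intro u v huv
    rw [Function.onFun, Set.disjoint_left]
    intro y hy hy'
    exact huv ((hDdec u y hy).symm.trans (hDdec v y hy'))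
  have hsum : ∑ u, (noiseMeasure s l).real (D u) ≤ 1 := by
    rw [← measureReal_iUnion_fintype hdisj hD]
    exact measureReal_le_one
  have hWH : ∀ u, W.real (H u) = 1 - (W (E u)).toReal := by
    intro u
    rw [measureReal_compl (measurableSet_toMeasurable _ _)]
    simp [measureReal_def, measure_toMeasurable]
  have hmsg : ∀ u, (1 - (W (E u)).toReal) * Real.log M ≤ A + M * (noiseMeasure s l).real (D u) := by
    intro u
    have := conv_msg σ s hσ hs l M hM (enc u) (D u) (hD u)
    rw [hDH u, hWH u] at this
    have := hA u
    linarith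
  have h2 := Finset.sum_le_sum fun u (_ : u ∈ Finset.univ) => hmsg u
  rw [← Finset.sum_mul, Finset.sum_sub_distrib, Finset.sum_add_distrib, ← Finset.mul_sum] at h2
  simp only [Finset.sum_const, Finset.card_univ, Fintype.card_fin, nsmul_eq_mul, mul_one] at h2
  have h3 : avgError σ l M enc dec * M = ∑ u, (W (E u)).toReal := by
    unfold avgError
    field_simp
    rfl
  rw [← h3] at h2
  have h4 : (M : ℝ) * ((1 - avgError σ l M enc dec) * Real.log M) ≤ M * (A + 1) := by
    have : (M : ℝ) * ∑ u, (noiseMeasure s l).real (D u) ≤ M * 1 := by gcongr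
    nlinarith
  exact le_of_mul_le_mul_left h4 hM'

lemma per_sum_mul (f : ℕ → ℝ) (N : ℕ) (hf : ∀ i, f (i + N) = f i) (k : ℕ) :
    ∑ i ∈ Finset.range (k * N), f i = k * ∑ i ∈ Finset.range N, f i := by
  have hp : ∀ (k i : ℕ), f (k * N + i) = f i := by
    intro k i
    induction k with
    | zero => simp
    | succ k ih => rw [← ih, ← hf (k * N + i)]; congr 1; ring
  induction k with
  | zero => simp
  | succ k ih =>
    rw [add_mul, one_mul, Finset.sum_range_add, ih]
    simp only [hp]
    push_cast; ring

lemma per_sum_bounds (f : ℕ → ℝ) (N : ℕ) (hN : 0 < N) (hf : ∀ i, f (i + N) = f i)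
    (h0 : ∀ i, 0 ≤ f i) (a : ℝ) (ha : ∑ i ∈ Finset.range N, f i = N * a) (l : ℕ) :
    ((l : ℝ) - N) * a ≤ ∑ i ∈ Finset.range l, f i ∧
      ∑ i ∈ Finset.range l, f i ≤ ((l : ℝ) + N) * a := by
  have hN' : (0 : ℝ) < N := by exact_mod_cast hN
  have ha0 : 0 ≤ a := by
    have : 0 ≤ N * a := ha ▸ Finset.sum_nonneg fun i _ => h0 i
    exact nonneg_of_mul_nonneg_right this hN'
  have h1 := Nat.div_mul_le_self l N
  have h2 := Nat.lt_div_mul_add (a := l) hN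
  have h1' : ((l / N : ℕ) : ℝ) * N ≤ l := by exact_mod_cast h1
  have h2' : (l : ℝ) ≤ ((l / N : ℕ) : ℝ) * N + N := by exact_mod_cast h2.le
  have e1 := per_sum_mul f N hf (l / N)
  have e2 := per_sum_mul f N hf (l / N + 1)
  rw [ha] at e1 e2
  push_cast at e2
  have m1 : ∑ i ∈ Finset.range (l / N * N), f i ≤ ∑ i ∈ Finset.range l, f i :=
    Finset.sum_le_sum_of_subset_of_nonneg (Finset.range_mono h1) fun i _ _ => h0 i
  have m2 : ∑ i ∈ Finset.range l, f i ≤ ∑ i ∈ Finset.range ((l / N + 1) * N), f i := by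
    refine Finset.sum_le_sum_of_subset_of_nonneg (Finset.range_mono ?_) fun i _ _ => h0 i
    rw [add_mul, one_mul]; exact h2.le
  constructor
  · refine le_trans ?_ (e1 ▸ m1)
    nlinarith
  · refine (e2 ▸ m2).trans ?_
    nlinarith

lemma converse_part (σ : ℕ → ℝ) (hσ : ∀ i, 0 < σ i) (N : ℕ) (hN : 0 < N)
    (hper : ∀ i, σ (i + N) = σ i) (P Δ C0 : ℝ) (hΔ : 0 < Δ)
    (hP : ∑ i ∈ Finset.range N, max (Δ - σ i) 0 = N * P)
    (hC : ∑ i ∈ Finset.range N, (1 / 2) * Real.log ((max (Δ - σ i) 0 + σ i) / σ i) = N * C0)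
    (hC0 : 0 ≤ C0) (R : ℝ) (hR : IsAchievableRate σ P R) : R ≤ C0 / Real.log 2 := by
  by_contra! hlt
  have hlog2 : 0 < Real.log 2 := Real.log_pos (by norm_num)
  set c := C0 / Real.log 2 with hc
  have hc0 : 0 ≤ c := by positivity
  have hcl : C0 = c * Real.log 2 := by rw [hc]; field_simp
  set d := (R - c) / 2 with hd
  have hd0 : 0 < d := by rw [hd]; linarith
  obtain ⟨l₀, hl₀⟩ := hR (d / (2 * (c + d))) (by positivity) d hd0
  obtain ⟨k, hk⟩ := exists_nat_gt (max (l₀ : ℝ) (1 / (d / 2 * Real.log 2)))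
  have hk1 : (l₀ : ℝ) < k := lt_of_le_of_lt (le_max_left _ _) hk
  have hk2 : 1 / (d / 2 * Real.log 2) < k := lt_of_le_of_lt (le_max_right _ _) hk
  have hk1' : l₀ < k := by exact_mod_cast hk1
  have hlk : k ≤ k * N := Nat.le_mul_of_pos_right k hN
  obtain ⟨l, hl⟩ : ∃ l, l = k * N := ⟨_, rfl⟩
  rw [← hl] at hlk
  obtain ⟨M, enc, dec, hpow, herr, hrate⟩ := hl₀ l (lt_of_lt_of_le hk1' hlk)
  have hlpos : (0 : ℝ) < l := by
    have : 0 < l := by omega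
    exact_mod_cast this
  set S : ℕ → ℝ := fun i => max (Δ - σ i) 0 with hS
  have hS0 : ∀ i, 0 ≤ S i := fun i => le_max_right _ _
  have hsum1 := per_sum_mul S N (fun i => by simp only [hS, hper]) k
  have hsum2 := per_sum_mul (fun i => (1 / 2) * Real.log ((S i + σ i) / σ i)) N
    (fun i => by simp only [hS, hper]) k
  rw [hP, ← mul_assoc, ← Nat.cast_mul, ← hl] at hsum1
  rw [hC, ← mul_assoc, ← Nat.cast_mul, ← hl] at hsum2
  have hconv := oneshot_conv σ (fun i => S i + σ i) hσ
    (fun i => add_pos_of_nonneg_of_pos (hS0 i) (hσ i)) l M enc dec (l * C0) (by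
      intro u
      have hp := hpow u
      unfold powerConstraint at hp
      rw [one_div, inv_mul_le_iff₀ hlpos] at hp
      rw [Finset.sum_add_distrib,
        Fin.sum_univ_eq_sum_range (fun i => (1 / 2) * Real.log ((S i + σ i) / σ i)) l, hsum2]
      have : ∑ i : Fin l, 1 / 2 * (((enc u i) ^ 2 + σ i) / (S i + σ i) - 1) ≤
          ∑ i : Fin l, 1 / (2 * Δ) * ((enc u i) ^ 2 - S i) := by
        refine Finset.sum_le_sum fun i _ => ?_
        have hσi := hσ i
        rcases le_total (Δ - σ i) 0 with h | h
        · have hSi : S i = 0 := max_eq_right h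
          rw [hSi, zero_add, sub_zero, add_div, div_self hσi.ne', add_sub_cancel_right]
          have : (enc u i) ^ 2 / σ i ≤ (enc u i) ^ 2 / Δ := by
            gcongr; linarith
          calc _ ≤ 1 / 2 * ((enc u i) ^ 2 / Δ) := by gcongr
            _ = _ := by field_simp
        · have hSi : S i = Δ - σ i := max_eq_left h
          rw [hSi, sub_add_cancel]
          apply le_of_eq
          field_simp
          ring
      have h4 : ∑ i : Fin l, 1 / (2 * Δ) * ((enc u i) ^ 2 - S i) =
          1 / (2 * Δ) * (∑ i, (enc u i) ^ 2 - l * P) := by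
        rw [← Finset.mul_sum, Finset.sum_sub_distrib, Fin.sum_univ_eq_sum_range S l, hsum1]
      rw [h4] at this
      have h3 : 1 / (2 * Δ) * (∑ i, (enc u i) ^ 2 - l * P) ≤ 0 :=
        mul_nonpos_of_nonneg_of_nonpos (by positivity) (by linarith)
      linarith)
  have hRd : R - d = c + d := by rw [hd]; ring
  rw [hRd, ge_iff_le, le_div_iff₀ hlpos, Real.logb, le_div_iff₀ hlog2] at hrate
  have hη : (1 - d / (2 * (c + d))) * (c + d) = c + d / 2 := by
    field_simp
    ring
  have hη1 : d / (2 * (c + d)) ≤ 1 / 2 := by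
    rw [div_le_div_iff₀ (by positivity) (by norm_num)]; linarith
  have h5 : (1 - d / (2 * (c + d))) * ((c + d) * l * Real.log 2) ≤ l * C0 + 1 := by
    refine le_trans ?_ hconv
    apply mul_le_mul (by linarith) hrate (by positivity) (by linarith)
  have h6 : (c + d / 2) * (l * Real.log 2) ≤ l * C0 + 1 := by
    rw [← hη]; linarith
  rw [hcl] at h6
  have h7 : (l : ℝ) * (d / 2 * Real.log 2) ≤ 1 := by linarith
  have h8 : 1 < (k : ℝ) * (d / 2 * Real.log 2) := by
    rwa [div_lt_iff₀ (by positivity)] at hk2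
  have h9 : (k : ℝ) ≤ l := by exact_mod_cast hlk
  have : (k : ℝ) * (d / 2 * Real.log 2) ≤ l * (d / 2 * Real.log 2) := by gcongr
  linarith

lemma log_concave (θ a : ℝ) (h0 : 0 ≤ θ) (h1 : θ ≤ 1) (ha : 0 ≤ a) :
    θ * Real.log (1 + a) ≤ Real.log (1 + θ * a) := by
  rw [← Real.log_rpow (by positivity)]
  exact Real.log_le_log (by positivity)
    (rpow_one_add_le_one_add_mul_self (by linarith) h0 h1)

lemma trivial_code (σ : ℕ → ℝ) (P : ℝ) (hP : 0 ≤ P) (l : ℕ) :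
    ∃ (enc : Fin 1 → Fin l → ℝ) (dec : (Fin l → ℝ) → Fin 1),
      (∀ u, powerConstraint P l (enc u)) ∧ avgError σ l 1 enc dec = 0 := by
  refine ⟨fun _ _ => 0, fun _ => 0, fun u => by simp [powerConstraint, hP], ?_⟩
  unfold avgError
  have : ∀ u : Fin 1, ¬ ((0 : Fin 1) ≠ u) := fun u => by simp [Subsingleton.elim u 0]
  simp [this]

lemma achievability_part (σ : ℕ → ℝ) (hσ : ∀ i, 0 < σ i) (N : ℕ) (hN : 0 < N)
    (hper : ∀ i, σ (i + N) = σ i) (P Δ C0 : ℝ) (hΔ : 0 < Δ) (hP0 : 0 < P)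
    (hP : ∑ i ∈ Finset.range N, max (Δ - σ i) 0 = N * P)
    (hC : ∑ i ∈ Finset.range N, (1 / 2) * Real.log ((max (Δ - σ i) 0 + σ i) / σ i) = N * C0)
    (hC0 : 0 ≤ C0) : IsAchievableRate σ P (C0 / Real.log 2) := by
  intro η₁ hη₁ η₂ hη₂
  have hlog2 : 0 < Real.log 2 := Real.log_pos (by norm_num)
  set g := η₂ * Real.log 2 with hg
  have hg0 : 0 < g := by positivity
  set r := C0 - g with hr
  have hrate : C0 / Real.log 2 - η₂ = r / Real.log 2 := by
    rw [hr, hg]; field_simp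
  rcases le_or_gt r 0 with hr0 | hr0
  · refine ⟨0, fun l _ => ?_⟩
    obtain ⟨enc, dec, h1, h2⟩ := trivial_code σ P hP0.le l
    refine ⟨1, enc, dec, h1, by rw [h2]; exact hη₁, ?_⟩
    rw [hrate]
    simp only [Nat.cast_one, Real.logb_one, zero_div]
    exact div_nonpos_of_nonpos_of_nonneg hr0 hlog2.le
  set κ := min (1 / 2) (g / (4 * (C0 + 1))) with hκ
  have hκ0 : 0 < κ := by rw [hκ]; positivity
  have hκ1 : κ ≤ 1 / 2 := min_le_left _ _
  have hκ2 : κ * C0 ≤ g / 4 := by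
    have h1 : κ ≤ g / (4 * (C0 + 1)) := min_le_right _ _
    calc κ * C0 ≤ κ * (C0 + 1) := by gcongr; linarith
      _ ≤ g / (4 * (C0 + 1)) * (C0 + 1) := by gcongr
      _ = g / 4 := by field_simp
  set δ := g / 4 with hδ
  have hδ0 : 0 < δ := by positivity
  set θ := 1 - κ with hθ
  set S : ℕ → ℝ := fun i => max (Δ - σ i) 0 with hS
  have hS0 : ∀ i, 0 ≤ S i := fun i => le_max_right _ _
  have hSΔ : ∀ i, S i ≤ Δ := fun i => max_le (by linarith [hσ i]) hΔ.le
  have hKK := KK_nonneg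
  have hN' : (0 : ℝ) < N := by exact_mod_cast hN
  have hT : Tendsto (fun l : ℕ => (l : ℝ)) atTop atTop := tendsto_natCast_atTop_atTop
  -- asymptotic conditions
  have ev1 : ∀ᶠ l : ℕ in atTop, 2 * N / κ ≤ (l : ℝ) := hT.eventually_ge_atTop _
  have ev2 : ∀ᶠ l : ℕ in atTop, 2 * (Δ ^ 2 * KK / (κ * P / 2) ^ 2) ≤ (l : ℝ) :=
    hT.eventually_ge_atTop _
  have ev3 : ∀ᶠ l : ℕ in atTop, 2 * KK / δ ^ 2 / (η₁ / 16) ≤ (l : ℝ) :=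
    hT.eventually_ge_atTop _
  have ev4 : ∀ᶠ l : ℕ in atTop, 2 * Real.exp (-(g / 2) * l + N * C0) < η₁ / 16 := by
    have : Tendsto (fun l : ℕ => 2 * Real.exp (-(g / 2) * l + N * C0)) atTop (𝓝 (2 * 0)) := by
      refine Tendsto.const_mul _ (Real.tendsto_exp_atBot.comp ?_)
      exact tendsto_atBot_add_const_right _ _ (hT.const_mul_atTop_of_neg (by linarith))
    rw [mul_zero] at this
    exact this.eventually_lt_const (by positivity)
  obtain ⟨l₀, hl₀⟩ := eventually_atTop.1
    (ev1.and (ev2.and (ev3.and ev4)))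
  refine ⟨l₀, fun l hl => ?_⟩
  obtain ⟨h1, h2, h3, h4⟩ := hl₀ l (le_of_lt hl)
  have hlpos : 0 < l := by omega
  have hl' : (0 : ℝ) < l := by exact_mod_cast hlpos
  rw [div_le_iff₀ hκ0] at h1
  set M := ⌈Real.exp (l * r)⌉₊ with hM
  have hMge : Real.exp (l * r) ≤ M := Nat.le_ceil _
  have hMle : (M : ℝ) ≤ 2 * Real.exp (l * r) := by
    have a1 := (Nat.ceil_lt_add_one (Real.exp_pos (l * r)).le).le
    have a2 : 1 ≤ Real.exp (l * r) := Real.one_le_exp (by positivity)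
    rw [hM]; linarith
  have hMpos : 0 < M := Nat.ceil_pos.2 (Real.exp_pos _)
  have hMpos' : (0 : ℝ) < M := by exact_mod_cast hMpos
  obtain ⟨-, hSsum⟩ := per_sum_bounds S N hN (fun i => by simp only [hS, hper]) hS0 P hP l
  obtain ⟨hfsum, -⟩ := per_sum_bounds (fun i => (1 / 2) * Real.log ((S i + σ i) / σ i)) N hN
    (fun i => by simp only [hS, hper]) (fun i => by
      have := hS0 i; have := hσ i
      have : 0 ≤ Real.log ((S i + σ i) / σ i) := Real.log_nonneg (by
        rw [le_div_iff₀ (hσ i)]; linarith)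
      positivity) C0 hC l
  have hθ0 : 0 ≤ θ := by rw [hθ]; linarith
  have hθ1 : θ ≤ 1 := by rw [hθ]; linarith
  have hfθ : θ * ∑ i ∈ Finset.range l, (1 / 2) * Real.log ((S i + σ i) / σ i) ≤
      ∑ i ∈ Finset.range l, (1 / 2) * Real.log ((θ * S i + σ i) / σ i) := by
    rw [Finset.mul_sum]
    refine Finset.sum_le_sum fun i _ => ?_
    have hσi := (hσ i).ne'
    have := log_concave θ (S i / σ i) hθ0 hθ1 (div_nonneg (hS0 i) (hσ i).le)
    have e1 : (S i + σ i) / σ i = 1 + S i / σ i := by field_simp; ring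
    have e2 : (θ * S i + σ i) / σ i = 1 + θ * (S i / σ i) := by field_simp; ring
    rw [e1, e2]; linarith
  obtain ⟨enc, dec, hpow, herr⟩ := oneshot_ach σ (fun i => θ * S i) hσ
    (fun i => mul_nonneg hθ0 (hS0 i)) Δ
    (fun i => (mul_le_of_le_one_left (hS0 i) hθ1).trans (hSΔ i)) P l M hlpos hMpos (η₁ / 2) δ
    (l * (κ * P / 2)) (by positivity) hδ0 (by positivity)
    (by
      rw [Fin.sum_univ_eq_sum_range (fun i => θ * S i) l, ← Finset.mul_sum]
      have : θ * ∑ i ∈ Finset.range l, S i ≤ θ * ((l + N) * P) := by gcongr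
      have h5 : θ * N * P ≤ l * κ / 2 * P := by
        gcongr
        calc θ * N ≤ 1 * N := by gcongr
          _ ≤ _ := by linarith
      have h6 : θ * ((l + N) * P) = (1 - κ) * l * P + θ * N * P := by rw [hθ]; ring
      linarith)
    (by
      have e : l * Δ ^ 2 * KK / (l * (κ * P / 2)) ^ 2 = (Δ ^ 2 * KK / (κ * P / 2) ^ 2) / l := by
        field_simp
      rw [e, div_le_iff₀ hl']; linarith)
    (by
      have e : 2 * (l * KK / (l * δ) ^ 2) = (2 * KK / δ ^ 2) / l := by field_simp
      have t1 : 2 * (l * KK / (l * δ) ^ 2) ≤ η₁ / 16 := by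
        rw [e, div_le_iff₀ hl']
        rw [div_le_iff₀ (by positivity)] at h3
        linarith
      have t2 : M * Real.exp (l * δ - ∑ i : Fin l, (1 / 2) *
          Real.log ((θ * S i + σ i) / σ i)) ≤ 2 * Real.exp (-(g / 2) * l + N * C0) := by
        rw [Fin.sum_univ_eq_sum_range (fun i => (1 / 2) * Real.log ((θ * S i + σ i) / σ i)) l]
        calc _ ≤ 2 * Real.exp (l * r) * Real.exp (l * δ - ∑ i ∈ Finset.range l, (1 / 2) *
              Real.log ((θ * S i + σ i) / σ i)) := by gcongr
          _ = 2 * Real.exp (l * r + (l * δ - ∑ i ∈ Finset.range l, (1 / 2) *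
              Real.log ((θ * S i + σ i) / σ i))) := by rw [Real.exp_add, mul_assoc]
          _ ≤ _ := by
            refine mul_le_mul_of_nonneg_left (Real.exp_le_exp.2 ?_) (by norm_num)
            have h5 : θ * ((l - N) * C0) ≤
              θ * ∑ i ∈ Finset.range l, (1 / 2) * Real.log ((S i + σ i) / σ i) := by gcongr
            have h6 : θ * (N * C0) ≤ 1 * (N * C0) := by gcongr
            have h7 : θ * ((l - N) * C0) = l * C0 - l * (κ * C0) - θ * (N * C0) := by
              rw [hθ]; ring
            have h8 : l * (κ * C0) ≤ l * δ := by gcongr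
            have h9 : l * r = l * C0 - l * g := by rw [hr]; ring
            have h10 : l * δ = l * g / 4 := by rw [hδ]; ring
            linarith
      linarith)
  refine ⟨M, enc, dec, hpow, by linarith, ?_⟩
  rw [hrate, ge_iff_le, Real.logb, div_div, mul_comm, ← div_div]
  refine div_le_div_of_nonneg_right ?_ hlog2.le
  rw [le_div_iff₀ hl', mul_comm, Real.le_log_iff_exp_le hMpos']
  exact hMge

/-- Synchronous sampling: `ε = u/v` with `u, v` positive integers (`u < v`, so
that `ε ∈ [0,1)`), and the sampled noise variance `σ_ε²[i] = C(i·T_c/(p+u/v))` is periodic with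
period `N = p·v + u`.  If `Δ > 0` solves the water-filling equation
`(1/N) ∑_{i<N} (Δ − σ_ε²[i])⁺ = P`, then the capacity of `Y_ε[i] = X[i] + W_ε[i]` under the
average power constraint `P` equals `(1/(2N)) ∑_{i<N} (log₂(Δ/σ_ε²[i]))⁺`. -/
theorem stmt5 (C : ℝ → ℝ) (T_c : ℝ) (hT : 0 < T_c)
    (hC_cont : Continuous C) (hC_pos : ∀ t, 0 < C t)
    (hC_per : ∀ t, C (t + T_c) = C t)
    (p u v : ℕ) (hp : 0 < p) (hu : 0 < u) (huv : u < v)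
    (P : ℝ) (hP : 0 < P)
    (σ2 : ℕ → ℝ)
    (hσ2 : ∀ i : ℕ, σ2 i = C ((i : ℝ) * T_c / ((p : ℝ) + (u : ℝ) / (v : ℝ))))
    (N : ℕ) (hN : N = p * v + u)
    (Δ : ℝ) (hΔpos : 0 < Δ)
    (hΔ : (1 / (N : ℝ)) * ∑ i ∈ Finset.range N, max (Δ - σ2 i) 0 = P) :
    capacity σ2 P =
      (1 / (2 * (N : ℝ))) * ∑ i ∈ Finset.range N, max (Real.logb 2 (Δ / σ2 i)) 0 := by
  have hv : (0 : ℝ) < v := by exact_mod_cast (hu.trans huv)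
  have hp' : (0 : ℝ) < p := by exact_mod_cast hp
  have hu' : (0 : ℝ) < u := by exact_mod_cast hu
  have hNpos : 0 < N := by rw [hN]; omega
  have hN' : (0 : ℝ) < N := by exact_mod_cast hNpos
  have hσ : ∀ i, 0 < σ2 i := fun i => by rw [hσ2]; exact hC_pos _
  have hper : ∀ i, σ2 (i + N) = σ2 i := by
    intro i
    have hCp : Function.Periodic C T_c := hC_per
    have := hCp.nat_mul v ((i : ℝ) * T_c / ((p : ℝ) + (u : ℝ) / (v : ℝ)))
    rw [hσ2, hσ2, ← this]
    congr 1
    rw [hN]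
    push_cast
    field_simp
  have hlog2 : 0 < Real.log 2 := Real.log_pos (by norm_num)
  have hP' : ∑ i ∈ Finset.range N, max (Δ - σ2 i) 0 = N * P := by
    rw [← hΔ]; field_simp
  set C0 : ℝ := (1 / (N : ℝ)) *
    ∑ i ∈ Finset.range N, (1 / 2) * Real.log ((max (Δ - σ2 i) 0 + σ2 i) / σ2 i) with hC0def
  have hC : ∑ i ∈ Finset.range N, (1 / 2) * Real.log ((max (Δ - σ2 i) 0 + σ2 i) / σ2 i) =
      N * C0 := by
    rw [hC0def]; field_simp
  have hlognn : ∀ i, 0 ≤ Real.log ((max (Δ - σ2 i) 0 + σ2 i) / σ2 i) := fun i =>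
    Real.log_nonneg (by
      rw [le_div_iff₀ (hσ i)]
      have := le_max_right (Δ - σ2 i) 0
      linarith)
  have hC0 : 0 ≤ C0 := by
    rw [hC0def]
    exact mul_nonneg (by positivity) (Finset.sum_nonneg fun i _ =>
      mul_nonneg (by norm_num) (hlognn i))
  have hval : (1 / (2 * (N : ℝ))) * ∑ i ∈ Finset.range N, max (Real.logb 2 (Δ / σ2 i)) 0 =
      C0 / Real.log 2 := by
    have e : ∀ i, max (Real.logb 2 (Δ / σ2 i)) 0 =
        Real.log ((max (Δ - σ2 i) 0 + σ2 i) / σ2 i) / Real.log 2 := by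
      intro i
      rcases le_total (Δ - σ2 i) 0 with h | h
      · rw [max_eq_right h, zero_add, div_self (hσ i).ne', Real.log_one, zero_div]
        apply max_eq_right
        apply Real.logb_nonpos (by norm_num) (div_pos hΔpos (hσ i)).le
        rw [div_le_one (hσ i)]; linarith
      · rw [max_eq_left h, sub_add_cancel]
        apply max_eq_left
        apply Real.logb_nonneg (by norm_num)
        rw [one_le_div (hσ i)]; linarith
    simp_rw [e]
    rw [hC0def, ← Finset.sum_div, ← Finset.mul_sum]
    field_simp
  rw [hval]
  apply le_antisymm
  · exact csSup_le ⟨_, achievability_part σ2 hσ N hNpos hper P Δ C0 hΔpos hP hP' hC hC0⟩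
      fun R hR => converse_part σ2 hσ N hNpos hper P Δ C0 hΔpos hP' hC hC0 R hR
  · exact le_csSup ⟨_, fun R hR =>
      converse_part σ2 hσ N hNpos hper P Δ C0 hΔpos hP' hC hC0 R hR⟩
      (achievability_part σ2 hσ N hNpos hper P Δ C0 hΔpos hP hP' hC hC0)
end

section
/- Let ε ∈ (0,1) be irrational. Then the capacity C_ε of the asynchronously-sampled channel Y_ε[i] = X[i] + W_ε[i] under the average power constraint P satisfies C_ε = liminf_{n→∞} C_n, where C_n is the capacity of the synchronously-sampled channel Y_n[i] = X[i] + W_n[i] with noise W_n[i] = W_c(i·T_c/(p+ε_n)), ε_n = ⌊n·ε⌋/n, under the same power constraint (each C_n given in closed form by the synchronous water-filling capacity formula with period N_n = p·n + ⌊n·ε⌋). Furthermore, Gaussian inputs are optimal for the channel Y_ε. -/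
open MeasureTheory ProbabilityTheory Filter Topology
open scoped NNReal ENNReal

/-- The scalar zero-mean Gaussian density with variance `v`. -/
noncomputable def gpdf (v x : ℝ) : ℝ :=
  (Real.sqrt (2 * Real.pi * v))⁻¹ * Real.exp (-(x ^ 2) / (2 * v))

/-- The mutual information density rate
`Z'_k = (1/k) log₂ ( p_{Y^{(k)}|X^{(k)}}(y|x) / p_{Y^{(k)}}(y) )` of the memoryless additive
Gaussian noise channel with a memoryless zero-mean Gaussian input, evaluated at the input
block `x` and the noise block `w` (so `y = x + w`): the input has variances `sX`, the noise has
variances `sW`, and hence `Y[i]` has variance `sX i + sW i`. -/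
noncomputable def infoDensRate (sX sW : ℕ → ℝ) (k : ℕ) (x w : Fin k → ℝ) : ℝ :=
  (1 / (k : ℝ)) * ∑ i : Fin k,
    Real.logb 2 (gpdf (sW ((i : ℕ) + 1)) (w i) /
      gpdf (sX ((i : ℕ) + 1) + sW ((i : ℕ) + 1)) (x i + w i))

/-- The joint law of `(X^{(k)}, W^{(k)})`: independent zero-mean Gaussian input entries with
variances `sX` and independent zero-mean Gaussian noise entries with variances `sW`. -/
noncomputable def inputNoiseMeasure (sX sW : ℕ → ℝ) (k : ℕ) :
    Measure ((Fin k → ℝ) × (Fin k → ℝ)) :=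
  (Measure.pi fun i : Fin k => gaussianReal 0 (sX ((i : ℕ) + 1)).toNNReal).prod
    (Measure.pi fun i : Fin k => gaussianReal 0 (sW ((i : ℕ) + 1)).toNNReal)

/-- The limit-inferior in probability of the mutual information density rates of the
memoryless Gaussian channel with Gaussian input variances `sX` and noise variances `sW`. -/
noncomputable def pliminfInfoDens (sX sW : ℕ → ℝ) : ℝ :=
  sSup {α : ℝ | Tendsto
    (fun k => ((inputNoiseMeasure sX sW k)
      {xw | infoDensRate sX sW k xw.1 xw.2 < α}).toReal) atTop (nhds 0)}

lemma cheb_pi {ι : Type*} [Fintype ι] (μ : ι → Measure ℝ) [∀ i, IsProbabilityMeasure (μ i)]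
    (f : ι → ℝ → ℝ) (hf : ∀ i, MemLp (f i) 2 (μ i)) (c : ℝ) (hc : 0 < c) (V : ℝ)
    (hV : ∑ i, Var[f i; μ i] ≤ V) :
    (Measure.pi μ) {w | c ≤ |∑ i, f i (w i) - ∑ i, ∫ x, f i x ∂(μ i)|} ≤
      ENNReal.ofReal (V / c ^ 2) := by
  have hm : ∀ i, MemLp (fun w : ι → ℝ => f i (w i)) 2 (Measure.pi μ) := fun i =>
    (hf i).comp_measurePreserving (measurePreserving_eval μ i)
  have hM : MemLp (∑ i, fun w : ι → ℝ => f i (w i)) 2 (Measure.pi μ) :=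
    memLp_finsetSum' _ (fun i _ => hm i)
  have h := meas_ge_le_variance_div_sq hM hc
  rw [variance_sum_pi hf] at h
  have hInteg : ∫ w, (∑ i, fun w : ι → ℝ => f i (w i)) w ∂(Measure.pi μ)
      = ∑ i, ∫ x, f i x ∂(μ i) := by
    simp only [Finset.sum_apply]
    rw [integral_finsetSum _ (fun i _ => (hm i).integrable (by norm_num))]
    refine Finset.sum_congr rfl fun i _ => ?_
    exact integral_comp_eval (hf i).aestronglyMeasurable
  rw [hInteg] at h
  simp only [Finset.sum_apply] at h
  refine h.trans (ENNReal.ofReal_le_ofReal ?_)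
  gcongr

lemma memLp_pow_gauss (v : ℝ≥0) (k : ℕ) : Integrable (fun x : ℝ => x ^ k) (gaussianReal 0 v) := by
  have := (memLp_id_gaussianReal (μ := 0) (v := v) (k : ℝ≥0)).integrable_norm_pow'
  refine this.mono (by fun_prop) (by simp)

lemma gauss_scale (v : ℝ≥0) :
    gaussianReal 0 v = (gaussianReal 0 1).map (fun x => Real.sqrt v * x) := by
  rw [gaussianReal_map_const_mul]
  congr 1
  · simp
  · ext; simp

lemma gauss_mom2 (v : ℝ≥0) : ∫ x, x ^ 2 ∂(gaussianReal 0 v) = v := by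
  have := variance_fun_id_gaussianReal (μ := 0) (v := v)
  rw [variance_eq_integral (by fun_prop)] at this
  simpa using this

lemma gauss_mom4 (v : ℝ≥0) : ∫ x, x ^ 4 ∂(gaussianReal 0 v) =
    (v : ℝ) ^ 2 * ∫ x, x ^ 4 ∂(gaussianReal 0 1) := by
  rw [gauss_scale, integral_map (by fun_prop) (by fun_prop), ← integral_const_mul]
  congr 1; ext x
  rw [mul_pow]
  congr 1
  rw [show (4:ℕ) = 2 * 2 from rfl, pow_mul, Real.sq_sqrt v.coe_nonneg]

/-- Fourth moment constant of the standard Gaussian. -/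
noncomputable def gaussK : ℝ := 2 * ∫ x, x ^ 4 ∂(gaussianReal 0 1) + 2

lemma gaussK_nonneg : 0 ≤ gaussK := by
  have : 0 ≤ ∫ x : ℝ, x ^ 4 ∂(gaussianReal 0 1) := integral_nonneg fun x => by positivity
  unfold gaussK; linarith

lemma quad_memLp (v : ℝ≥0) (a b : ℝ) :
    MemLp (fun x : ℝ => a * x ^ 2 + b * x) 2 (gaussianReal 0 v) := by
  rw [memLp_two_iff_integrable_sq (by fun_prop)]
  have : (fun x : ℝ => (a * x ^ 2 + b * x) ^ 2) =
      fun x => a ^ 2 * x ^ 4 + 2 * a * b * x ^ 3 + b ^ 2 * x ^ 2 := by ext x; ring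
  rw [this]
  exact (((memLp_pow_gauss v 4).const_mul _).add ((memLp_pow_gauss v 3).const_mul _)).add
    ((memLp_pow_gauss v 2).const_mul _)

lemma quad_mean (v : ℝ≥0) (a b : ℝ) :
    ∫ x, (a * x ^ 2 + b * x) ∂(gaussianReal 0 v) = a * v := by
  have h1 : Integrable (fun x : ℝ => x) (gaussianReal 0 v) := by simpa using memLp_pow_gauss v 1
  rw [integral_add ((memLp_pow_gauss v 2).const_mul _) (h1.const_mul _), integral_const_mul,
    integral_const_mul, gauss_mom2, integral_id_gaussianReal]
  ring

lemma quad_var (v : ℝ≥0) (a b : ℝ) :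
    Var[fun x : ℝ => a * x ^ 2 + b * x; gaussianReal 0 v] ≤
      gaussK * (a ^ 2 * (v : ℝ) ^ 2 + b ^ 2 * v) := by
  refine (variance_le_expectation_sq (by fun_prop)).trans ?_
  have h : ∫ x, ((fun x : ℝ => a * x ^ 2 + b * x) ^ 2) x ∂(gaussianReal 0 v) ≤
      ∫ x, (2 * a ^ 2 * x ^ 4 + 2 * b ^ 2 * x ^ 2) ∂(gaussianReal 0 v) := by
    apply integral_mono_of_nonneg
    · exact Filter.Eventually.of_forall fun x => by simp only [Pi.pow_apply, Pi.zero_apply]; positivity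
    · exact ((memLp_pow_gauss v 4).const_mul _).add ((memLp_pow_gauss v 2).const_mul _)
    · exact Filter.Eventually.of_forall fun x => by
        simp only [Pi.pow_apply]
        nlinarith [sq_nonneg (a * x ^ 2 - b * x)]
  refine h.trans ?_
  rw [integral_add ((memLp_pow_gauss v 4).const_mul _) ((memLp_pow_gauss v 2).const_mul _),
    integral_const_mul, integral_const_mul, gauss_mom2, gauss_mom4]
  have : 0 ≤ ∫ x : ℝ, x ^ 4 ∂(gaussianReal 0 1) := integral_nonneg fun x => by positivity
  unfold gaussK
  have hv := v.2
  have e1 : 0 ≤ a ^ 2 * (v:ℝ) ^ 2 := by positivity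
  have e2 : 0 ≤ b ^ 2 * (v:ℝ) := by positivity
  nlinarith [mul_nonneg e2 this]

/-- Chebyshev for quadratic functions of independent Gaussians. -/
lemma cheb_gauss {ι : Type*} [Fintype ι] (v : ι → ℝ) (hv : ∀ i, 0 ≤ v i) (a b : ι → ℝ)
    (c : ℝ) (hc : 0 < c) (V : ℝ) (hV : ∑ i, (a i ^ 2 * v i ^ 2 + b i ^ 2 * v i) ≤ V) :
    (Measure.pi fun i => gaussianReal 0 (v i).toNNReal)
      {w | c ≤ |∑ i, (a i * w i ^ 2 + b i * w i) - ∑ i, a i * v i|} ≤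
      ENNReal.ofReal (gaussK * V / c ^ 2) := by
  have h := cheb_pi (fun i => gaussianReal 0 (v i).toNNReal)
    (fun i x => a i * x ^ 2 + b i * x) (fun i => quad_memLp _ _ _) c hc (gaussK * V) ?_
  · simpa only [quad_mean, Real.coe_toNNReal _ (hv _)] using h
  · calc _ ≤ ∑ i, gaussK * (a i ^ 2 * v i ^ 2 + b i ^ 2 * v i) := by
          refine Finset.sum_le_sum fun i _ => ?_
          have := quad_var (v i).toNNReal (a i) (b i)
          rwa [Real.coe_toNNReal _ (hv i)] at this
      _ ≤ _ := by
          rw [← Finset.mul_sum]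
          exact mul_le_mul_of_nonneg_left hV gaussK_nonneg

lemma pi_gauss_apply {ι : Type*} [Fintype ι] (m : ι → ℝ) (v : ι → ℝ≥0) (hv : ∀ i, v i ≠ 0)
    (S : Set (ι → ℝ)) (hS : MeasurableSet S) :
    (Measure.pi fun i => gaussianReal (m i) (v i)) S =
      ∫⁻ y in S, ENNReal.ofReal (∏ i, gaussianPDFReal (m i) (v i) (y i)) := by
  have key : (Measure.pi fun i => gaussianReal (m i) (v i)) =
      (volume : Measure (ι → ℝ)).withDensity
        (fun y => ENNReal.ofReal (∏ i, gaussianPDFReal (m i) (v i) (y i))) := by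
    refine Measure.pi_eq fun s hs => ?_
    rw [withDensity_apply _ (MeasurableSet.univ_pi hs), ← lintegral_indicator (MeasurableSet.univ_pi hs)]
    have e1 : ∀ y : ι → ℝ, (Set.univ.pi s).indicator
        (fun y => ENNReal.ofReal (∏ i, gaussianPDFReal (m i) (v i) (y i))) y =
        ENNReal.ofReal (∏ i, (s i).indicator (gaussianPDFReal (m i) (v i)) (y i)) := by
      intro y
      by_cases hy : y ∈ Set.univ.pi s
      · rw [Set.indicator_of_mem hy]
        congr 1
        refine Finset.prod_congr rfl fun i _ => ?_
        rw [Set.indicator_of_mem (hy i (Set.mem_univ i))]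
      · rw [Set.indicator_of_notMem hy]
        simp only [Set.mem_univ_pi, not_forall] at hy
        obtain ⟨i, hi⟩ := hy
        rw [Finset.prod_eq_zero (Finset.mem_univ i) (Set.indicator_of_notMem hi _), ENNReal.ofReal_zero]
    simp_rw [e1]
    have hInteg : ∀ i, Integrable ((s i).indicator (gaussianPDFReal (m i) (v i))) :=
      fun i => (integrable_gaussianPDFReal _ _).indicator (hs i)
    have hnn : ∀ i x, 0 ≤ (s i).indicator (gaussianPDFReal (m i) (v i)) x :=
      fun i x => Set.indicator_nonneg (fun _ _ => gaussianPDFReal_nonneg _ _ _) _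
    rw [← ofReal_integral_eq_lintegral_ofReal]
    · rw [integral_fintype_prod_volume_eq_prod, ENNReal.ofReal_prod_of_nonneg
        (fun i _ => integral_nonneg (hnn i))]
      refine Finset.prod_congr rfl fun i _ => ?_
      rw [gaussianReal_apply_eq_integral _ (hv i), integral_indicator (hs i)]
    · exact Integrable.fintype_prod hInteg
    · exact Filter.Eventually.of_forall fun y => Finset.prod_nonneg fun i _ => hnn i _
  rw [key, withDensity_apply _ hS]

lemma pi_gauss_le {ι : Type*} [Fintype ι] (m m' : ι → ℝ) (v v' : ι → ℝ≥0) (hv : ∀ i, v i ≠ 0)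
    (hv' : ∀ i, v' i ≠ 0) (S : Set (ι → ℝ)) (hS : MeasurableSet S) (a : ℝ) (ha : 0 ≤ a)
    (h : ∀ y ∈ S, ∏ i, gaussianPDFReal (m i) (v i) (y i) ≤
      a * ∏ i, gaussianPDFReal (m' i) (v' i) (y i)) :
    (Measure.pi fun i => gaussianReal (m i) (v i)) S ≤
      ENNReal.ofReal a * (Measure.pi fun i => gaussianReal (m' i) (v' i)) S := by
  rw [pi_gauss_apply m v hv S hS, pi_gauss_apply m' v' hv' S hS, ← lintegral_const_mul']
  · refine setLIntegral_mono' hS fun y hy => ?_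
    rw [← ENNReal.ofReal_mul ha]
    exact ENNReal.ofReal_le_ofReal (h y hy)
  · exact ENNReal.ofReal_ne_top

lemma noise_shift {ι : Type*} [Fintype ι] (x : ι → ℝ) (v : ι → ℝ≥0) :
    (Measure.pi fun i => gaussianReal 0 (v i)).map (fun w i => x i + w i) =
      Measure.pi fun i => gaussianReal (x i) (v i) := by
  have := Measure.pi_map_pi (μ := fun i => gaussianReal 0 (v i)) (f := fun i w => x i + w)
    (hμ := fun i => by rw [gaussianReal_map_const_add]; infer_instance) (fun i => by fun_prop)
  rw [this]
  congr 1; ext1 i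
  rw [gaussianReal_map_const_add, zero_add]

lemma sum_law {ι : Type*} [Fintype ι] (s v : ι → ℝ) (hs : ∀ i, 0 ≤ s i) (hv : ∀ i, 0 ≤ v i) :
    ((Measure.pi fun i => gaussianReal 0 (s i).toNNReal).prod
      (Measure.pi fun i => gaussianReal 0 (v i).toNNReal)).map (fun xw i => xw.1 i + xw.2 i) =
      Measure.pi fun i => gaussianReal 0 (s i + v i).toNNReal := by
  rw [← (measurePreserving_arrowProdEquivProdArrow ℝ ℝ ι (fun i => gaussianReal 0 (s i).toNNReal)
    (fun i => gaussianReal 0 (v i).toNNReal)).map_eq, Measure.map_map (by fun_prop) (by fun_prop)]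
  have hmap : ∀ i, ((gaussianReal 0 (s i).toNNReal).prod (gaussianReal 0 (v i).toNNReal)).map
      (fun z : ℝ × ℝ => z.1 + z.2) = gaussianReal 0 (s i + v i).toNNReal := by
    intro i
    have := gaussianReal_conv_gaussianReal (m₁ := 0) (m₂ := 0) (v₁ := (s i).toNNReal)
      (v₂ := (v i).toNNReal)
    rw [Measure.conv] at this
    rw [this, Real.toNNReal_add (hs i) (hv i), add_zero]
  have := Measure.pi_map_pi (μ := fun i => (gaussianReal 0 (s i).toNNReal).prod
    (gaussianReal 0 (v i).toNNReal)) (f := fun i (z : ℝ × ℝ) => z.1 + z.2)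
    (hμ := fun i => by rw [hmap]; infer_instance) (fun i => by fun_prop)
  simp_rw [hmap] at this
  rw [← this]
  rfl

/-- Log density ratio (in nats) of one coordinate. -/
noncomputable def idens (τ σ x y : ℝ) : ℝ :=
  Real.log (τ / σ) / 2 + y ^ 2 / (2 * τ) - (y - x) ^ 2 / (2 * σ)

lemma gaussPDF_ratio (τ σ : ℝ) (hτ : 0 < τ) (hσ : 0 < σ) (x y : ℝ) :
    gaussianPDFReal x σ.toNNReal y =
      Real.exp (idens τ σ x y) * gaussianPDFReal 0 τ.toNNReal y := by
  rw [gaussianPDFReal, gaussianPDFReal, Real.coe_toNNReal _ hτ.le, Real.coe_toNNReal _ hσ.le, idens]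
  have h1 : Real.exp (Real.log (τ / σ) / 2 + y ^ 2 / (2 * τ) - (y - x) ^ 2 / (2 * σ)) =
      Real.sqrt (τ / σ) * Real.exp (y ^ 2 / (2 * τ)) * Real.exp (-(y - x) ^ 2 / (2 * σ)) := by
    have : Real.sqrt (τ / σ) = Real.exp (Real.log (τ / σ) / 2) := by
      rw [← Real.log_sqrt (by positivity), Real.exp_log (by positivity)]
    rw [this, ← Real.exp_add, ← Real.exp_add]
    congr 1; ring
  rw [h1]
  have h2 : Real.exp (y ^ 2 / (2 * τ)) * Real.exp (-(y - 0) ^ 2 / (2 * τ)) = 1 := by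
    rw [← Real.exp_add, ← Real.exp_zero]; congr 1; ring
  have h3 : (Real.sqrt (2 * Real.pi * σ))⁻¹ =
      Real.sqrt (τ / σ) * (Real.sqrt (2 * Real.pi * τ))⁻¹ := by
    rw [Real.sqrt_div hτ.le, Real.sqrt_mul (show 0 ≤ 2 * Real.pi by positivity) σ,
      Real.sqrt_mul (show 0 ≤ 2 * Real.pi by positivity) τ]
    have := Real.sqrt_pos.2 hτ
    have := Real.sqrt_pos.2 hσ
    have := Real.sqrt_pos.2 (show 0 < 2 * Real.pi by positivity)
    field_simp
  rw [h3]
  calc _ = Real.sqrt (τ / σ) * (Real.sqrt (2 * Real.pi * τ))⁻¹ * Real.exp (-(y - x) ^ 2 / (2 * σ)) * 1 := by ring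
    _ = _ := by rw [← h2]; ring

lemma prod_ratio {ι : Type*} [Fintype ι] (τ σ : ι → ℝ) (hτ : ∀ i, 0 < τ i) (hσ : ∀ i, 0 < σ i)
    (x y : ι → ℝ) :
    ∏ i, gaussianPDFReal (x i) (σ i).toNNReal (y i) =
      Real.exp (∑ i, idens (τ i) (σ i) (x i) (y i)) *
        ∏ i, gaussianPDFReal 0 (τ i).toNNReal (y i) := by
  rw [Real.exp_sum, ← Finset.prod_mul_distrib]
  exact Finset.prod_congr rfl fun i _ => gaussPDF_ratio _ _ (hτ i) (hσ i) _ _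

lemma gpdf_eq (v x : ℝ) (hv : 0 < v) : gpdf v x = gaussianPDFReal 0 v.toNNReal x := by
  rw [gpdf, gaussianPDFReal, Real.coe_toNNReal _ hv.le, sub_zero]

lemma logb_gpdf (τ σ x w : ℝ) (hτ : 0 < τ) (hσ : 0 < σ) :
    Real.logb 2 (gpdf σ w / gpdf τ (x + w)) = idens τ σ x (x + w) / Real.log 2 := by
  have h0 : gpdf σ w = gaussianPDFReal x σ.toNNReal (x + w) := by
    rw [gpdf_eq _ _ hσ, gaussianPDFReal, gaussianPDFReal]; congr 3; ring
  have hp : 0 < gaussianPDFReal 0 τ.toNNReal (x + w) :=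
    gaussianPDFReal_pos _ _ _ (by simpa using hτ)
  rw [h0, gpdf_eq _ _ hτ, gaussPDF_ratio τ σ hτ hσ, mul_div_assoc, div_self hp.ne', mul_one,
    Real.logb, Real.log_exp]

lemma info_conc {ι : Type*} [Fintype ι] (s v : ι → ℝ) (hs : ∀ i, 0 ≤ s i) (hv : ∀ i, 0 < v i)
    (c : ℝ) (hc : 0 < c) :
    ((Measure.pi fun i => gaussianReal 0 (s i).toNNReal).prod
      (Measure.pi fun i => gaussianReal 0 (v i).toNNReal))
      {xw | c ≤ |∑ i, idens (s i + v i) (v i) (xw.1 i) (xw.1 i + xw.2 i) -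
        ∑ i, Real.log ((s i + v i) / v i) / 2|} ≤
      ENNReal.ofReal (2 * (gaussK * Fintype.card ι / c ^ 2)) := by
  set μ := (Measure.pi fun i => gaussianReal 0 (s i).toNNReal).prod
      (Measure.pi fun i => gaussianReal 0 (v i).toNNReal) with hμ
  set E1 : Set (ι → ℝ) := {y | c / 2 ≤ |∑ i, (1 / (2 * (s i + v i)) * y i ^ 2 + 0 * y i) -
    ∑ i, 1 / (2 * (s i + v i)) * (s i + v i)|} with hE1
  set E2 : Set (ι → ℝ) := {w | c / 2 ≤ |∑ i, (1 / (2 * v i) * w i ^ 2 + 0 * w i) -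
    ∑ i, 1 / (2 * v i) * v i|} with hE2
  have hp : ∀ i, 0 < s i + v i := fun i => add_pos_of_nonneg_of_pos (hs i) (hv i)
  have hb1 := cheb_gauss (fun i => s i + v i) (fun i => (hp i).le)
    (fun i => 1 / (2 * (s i + v i))) (fun _ => 0) (c / 2) (by positivity)
    ((Fintype.card ι : ℝ) / 4) (by
      rw [← nsmul_one, smul_div_assoc, ← Finset.card_univ, ← Finset.sum_const]
      refine Finset.sum_le_sum fun i _ => le_of_eq ?_
      have := hp i
      field_simp; norm_num)
  have hb2 := cheb_gauss v (fun i => (hv i).le)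
    (fun i => 1 / (2 * v i)) (fun _ => 0) (c / 2) (by positivity)
    ((Fintype.card ι : ℝ) / 4) (by
      rw [← nsmul_one, smul_div_assoc, ← Finset.card_univ, ← Finset.sum_const]
      refine Finset.sum_le_sum fun i _ => le_of_eq ?_
      have := hv i
      field_simp; norm_num)
  rw [← sum_law s v hs (fun i => (hv i).le), ← hμ] at hb1
  have hm1 : MeasurableSet E1 := measurableSet_le (by fun_prop) (by fun_prop)
  have hm2 : MeasurableSet E2 := measurableSet_le (by fun_prop) (by fun_prop)
  rw [Measure.map_apply (by fun_prop) hm1] at hb1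
  have hsnd : μ (Prod.snd ⁻¹' E2) ≤ ENNReal.ofReal (gaussK * (Fintype.card ι / 4) / (c / 2) ^ 2) := by
    rw [← Set.univ_prod, hμ, Measure.prod_prod]
    rw [measure_univ, one_mul]
    exact hb2
  have hsub : {xw : (ι → ℝ) × (ι → ℝ) | c ≤ |∑ i, idens (s i + v i) (v i) (xw.1 i) (xw.1 i + xw.2 i) -
        ∑ i, Real.log ((s i + v i) / v i) / 2|} ⊆
      ((fun xw i => xw.1 i + xw.2 i) ⁻¹' E1) ∪ (Prod.snd ⁻¹' E2) := by
    intro xw h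
    by_contra hcon
    simp only [Set.mem_union, not_or, hE1, hE2, Set.mem_preimage, Set.mem_ofPred_eq, not_le] at hcon
    obtain ⟨h1, h2⟩ := hcon
    simp only [Set.mem_ofPred_eq] at h
    have heq : ∑ i, idens (s i + v i) (v i) (xw.1 i) (xw.1 i + xw.2 i) -
        ∑ i, Real.log ((s i + v i) / v i) / 2 =
        (∑ i, (1 / (2 * (s i + v i)) * (xw.1 i + xw.2 i) ^ 2 + 0 * (xw.1 i + xw.2 i)) -
          ∑ i, 1 / (2 * (s i + v i)) * (s i + v i)) -
        (∑ i, (1 / (2 * v i) * xw.2 i ^ 2 + 0 * xw.2 i) - ∑ i, 1 / (2 * v i) * v i) := by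
      simp only [← Finset.sum_sub_distrib]
      refine Finset.sum_congr rfl fun i _ => ?_
      have := hp i
      have := hv i
      rw [idens]
      field_simp
      ring
    rw [heq] at h
    have := abs_sub (∑ i, (1 / (2 * (s i + v i)) * (xw.1 i + xw.2 i) ^ 2 + 0 * (xw.1 i + xw.2 i)) -
          ∑ i, 1 / (2 * (s i + v i)) * (s i + v i))
        (∑ i, (1 / (2 * v i) * xw.2 i ^ 2 + 0 * xw.2 i) - ∑ i, 1 / (2 * v i) * v i)
    linarith
  refine (measure_mono hsub).trans ((measure_union_le _ _).trans ((add_le_add hb1 hsnd).trans ?_))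
  have hK := gaussK_nonneg
  rw [← ENNReal.ofReal_add (by positivity) (by positivity)]
  refine ENNReal.ofReal_le_ofReal (le_of_eq ?_)
  field_simp
  ring

/-- Feinstein's lemma. -/
lemma feinstein_s8 {X Y : Type*} [MeasurableSpace X] [MeasurableSpace Y] (μ : Measure X)
    [IsProbabilityMeasure μ] [Nonempty X] (κ : X → Measure Y) [∀ x, IsProbabilityMeasure (κ x)]
    (ν : Measure Y) (D : X → Set Y) (hDm : ∀ x, MeasurableSet (D x)) (A : Set X)
    (hA : MeasurableSet A) (hκm : ∀ U, MeasurableSet U → Measurable fun x => κ x U)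
    (hν : ∀ U, MeasurableSet U → ∫⁻ x, κ x U ∂μ ≤ ν U) (b : ℝ≥0∞) (hD : ∀ x, ν (D x) ≤ b)
    (e : ℝ≥0∞) (he : e ≤ 1) (M : ℕ)
    (H : ∫⁻ x, κ x (D x)ᶜ ∂μ + μ Aᶜ + M * b < e) :
    ∃ (enc : ℕ → X) (R : ℕ → Set Y), (∀ u < M, MeasurableSet (R u) ∧ R u ⊆ D (enc u) ∧
      enc u ∈ A ∧ κ (enc u) (R u)ᶜ ≤ e ∧ ∀ u' < u, Disjoint (R u') (R u)) := by
  induction M with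
  | zero => exact ⟨fun _ => Classical.arbitrary X, fun _ => ∅, by simp⟩
  | succ M ih =>
    have H' : ∫⁻ x, κ x (D x)ᶜ ∂μ + μ Aᶜ + M * b < e := by
      refine lt_of_le_of_lt ?_ H
      gcongr
      simp
    obtain ⟨enc, R, h⟩ := ih H'
    set U : Set Y := ⋃ u ∈ Finset.range M, R u with hU
    have hUm : MeasurableSet U :=
      Finset.measurableSet_biUnion _ fun u hu => (h u (Finset.mem_range.1 hu)).1
    have hUν : ν U ≤ M * b := by
      refine (measure_biUnion_finset_le _ _).trans ?_
      calc _ ≤ ∑ u ∈ Finset.range M, b := Finset.sum_le_sum fun u hu =>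
            (measure_mono (h u (Finset.mem_range.1 hu)).2.1).trans (hD _)
        _ = _ := by simp
    obtain ⟨x, hxA, hx⟩ : ∃ x ∈ A, κ x (D x \ U)ᶜ ≤ e := by
      by_contra hcon
      push Not at hcon
      have hle : ∀ x, e ≤ κ x (D x)ᶜ + (κ x U + Aᶜ.indicator (fun _ => 1) x) := by
        intro x
        by_cases hx : x ∈ A
        · refine (hcon x hx).le.trans ?_
          have : (D x \ U)ᶜ ⊆ (D x)ᶜ ∪ U := by
            intro y hy
            by_cases hyU : y ∈ U
            · exact Or.inr hyU
            · exact Or.inl fun hyD => hy ⟨hyD, hyU⟩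
          refine ((measure_mono this).trans (measure_union_le _ _)).trans ?_
          gcongr
          exact le_self_add
        · rw [Set.indicator_of_mem (show x ∈ Aᶜ from hx)]
          refine he.trans ?_
          rw [← add_assoc]
          exact le_add_self
      have hInteg : e ≤ ∫⁻ x, κ x (D x)ᶜ ∂μ + (∫⁻ x, κ x U ∂μ + μ Aᶜ) := by
        calc e = ∫⁻ _, e ∂μ := by simp
          _ ≤ ∫⁻ x, κ x (D x)ᶜ + (κ x U + Aᶜ.indicator (fun _ => 1) x) ∂μ := lintegral_mono hle
          _ = _ := by
            have hi : Measurable (Aᶜ.indicator (fun _ : X => (1 : ℝ≥0∞))) :=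
              measurable_const.indicator hA.compl
            have hs : Measurable fun x => κ x U + Aᶜ.indicator (fun _ : X => (1 : ℝ≥0∞)) x :=
              (hκm U hUm).add hi
            rw [lintegral_add_right _ hs,
              lintegral_add_left (hκm U hUm), lintegral_indicator_const hA.compl, one_mul]
      refine absurd (hInteg.trans ?_) (not_le.2 H)
      calc _ ≤ ∫⁻ x, κ x (D x)ᶜ ∂μ + (M * b + μ Aᶜ) := by
            gcongr
            exact (hν U hUm).trans hUν
        _ ≤ ∫⁻ x, κ x (D x)ᶜ ∂μ + (((M + 1 : ℕ) : ℝ≥0∞) * b + μ Aᶜ) := by gcongr; simp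
        _ = _ := by ring
    refine ⟨Function.update enc M x, Function.update R M (D x \ U), fun u hu => ?_⟩
    rcases Nat.lt_succ_iff_lt_or_eq.1 hu with hu | rfl
    · have hne : u ≠ M := hu.ne
      obtain ⟨h1, h2, h3, h4, h5⟩ := h u hu
      simp only [Function.update_of_ne hne]
      refine ⟨h1, h2, h3, h4, fun u' hu' => ?_⟩
      rw [Function.update_of_ne (by omega)]
      exact h5 u' hu'
    · simp only [Function.update_self]
      refine ⟨(hDm x).diff hUm, Set.sdiff_subset, hxA, hx, fun u' hu' => ?_⟩
      rw [Function.update_of_ne hu'.ne]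
      rw [Set.disjoint_left]
      intro y hy hy'
      exact hy'.2 (Set.mem_biUnion (Finset.mem_coe.2 (Finset.mem_range.2 hu')) hy)

lemma measurable_sum_idens {ι α : Type*} [Fintype ι] [MeasurableSpace α] (τ σ : ι → ℝ)
    (f g : α → ι → ℝ) (hf : Measurable f) (hg : Measurable g) :
    Measurable fun z => ∑ i, idens (τ i) (σ i) (f z i) (g z i) := by
  unfold idens
  fun_prop

lemma code_core (l : ℕ) (hl : 0 < l) (s v : Fin l → ℝ) (hs : ∀ i, 0 ≤ s i) (hv : ∀ i, 0 < v i)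
    (T c P d : ℝ) (hc : 0 < c) (hT : T + c ≤ ∑ i, Real.log ((s i + v i) / v i) / 2)
    (hd : 0 < d) (hP : ∑ i, s i + d ≤ l * P) (M : ℕ) (e : ℝ≥0∞) (he : e ≤ 1)
    (H : ENNReal.ofReal (2 * (gaussK * l / c ^ 2)) +
      ENNReal.ofReal (gaussK * (∑ i, s i ^ 2) / d ^ 2) +
      M * ENNReal.ofReal (Real.exp (-T)) < e) :
    ∃ (enc : ℕ → Fin l → ℝ) (R : ℕ → Set (Fin l → ℝ)), ∀ u < M, powerConstraint P l (enc u) ∧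
      (Measure.pi fun i => gaussianReal 0 (v i).toNNReal) {w | (fun i => enc u i + w i) ∉ R u} ≤ e ∧
      ∀ u' < u, Disjoint (R u') (R u) := by
  set μ := Measure.pi fun i => gaussianReal 0 (s i).toNNReal with hμ
  set N := Measure.pi fun i => gaussianReal 0 (v i).toNNReal with hN
  set ν := Measure.pi fun i => gaussianReal 0 (s i + v i).toNNReal with hν
  have hp : ∀ i, 0 < s i + v i := fun i => add_pos_of_nonneg_of_pos (hs i) (hv i)
  let κ : (Fin l → ℝ) → Measure (Fin l → ℝ) := fun x => N.map (fun w i => x i + w i)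
  have hκp : ∀ x, IsProbabilityMeasure (κ x) := fun x =>
    Measure.isProbabilityMeasure_map (show Measurable fun (w : Fin l → ℝ) i => x i + w i by fun_prop).aemeasurable
  let D : (Fin l → ℝ) → Set (Fin l → ℝ) := fun x =>
    {y | T < ∑ i, idens (s i + v i) (v i) (x i) (y i)}
  have hDm : ∀ x, MeasurableSet (D x) := fun x =>
    measurableSet_lt measurable_const
      (measurable_sum_idens _ _ (fun _ => x) (fun y => y) measurable_const measurable_id)
  let A : Set (Fin l → ℝ) := {x | ∑ i, x i ^ 2 ≤ l * P}
  have hAm : MeasurableSet A := measurableSet_le (by fun_prop) (by fun_prop)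
  have hkey : ∀ S : Set ((Fin l → ℝ) × (Fin l → ℝ)), MeasurableSet S → ∀ x,
      κ x (Prod.mk x ⁻¹' S) = N (Prod.mk x ⁻¹'
        ((fun xw : (Fin l → ℝ) × (Fin l → ℝ) => (xw.1, fun i => xw.1 i + xw.2 i)) ⁻¹' S)) := by
    intro S hS x
    rw [Measure.map_apply (by fun_prop) (measurable_prodMk_left hS)]
    rfl
  have hkey2 : ∀ S : Set ((Fin l → ℝ) × (Fin l → ℝ)), MeasurableSet S →
      ∫⁻ x, κ x (Prod.mk x ⁻¹' S) ∂μ = (μ.prod N)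
        ((fun xw : (Fin l → ℝ) × (Fin l → ℝ) => (xw.1, fun i => xw.1 i + xw.2 i)) ⁻¹' S) := by
    intro S hS
    simp_rw [hkey S hS]
    rw [Measure.prod_apply]
    exact (show Measurable fun xw : (Fin l → ℝ) × (Fin l → ℝ) =>
      (xw.1, fun i => xw.1 i + xw.2 i) by fun_prop) hS
  have hF0 : ∀ U, MeasurableSet U → Measurable fun x => κ x U := by
    intro U hU
    have : Measurable fun x => N (Prod.mk x ⁻¹'
        ((fun xw : (Fin l → ℝ) × (Fin l → ℝ) => (fun i => xw.1 i + xw.2 i)) ⁻¹' U)) :=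
      measurable_measure_prodMk_left ((show Measurable fun xw : (Fin l → ℝ) × (Fin l → ℝ) =>
        (fun i => xw.1 i + xw.2 i) by fun_prop) hU)
    convert this using 2 with x
    rw [Measure.map_apply (by fun_prop) hU]
    rfl
  have hF1 : ∀ U, MeasurableSet U → ∫⁻ x, κ x U ∂μ ≤ ν U := by
    intro U hU
    have := hkey2 (Set.univ ×ˢ U) (MeasurableSet.univ.prod hU)
    simp only [Set.mk_preimage_prod_right (Set.mem_univ _)] at this
    rw [this, hν, ← sum_law s v hs (fun i => (hv i).le), Measure.map_apply (by fun_prop) hU]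
    refine measure_mono ?_
    intro xw hxw
    exact hxw.2
  have hF2 : ∀ x, ν (D x) ≤ ENNReal.ofReal (Real.exp (-T)) := by
    intro x
    have h1 := pi_gauss_le (fun _ => 0) x (fun i => (s i + v i).toNNReal) (fun i => (v i).toNNReal)
      (fun i => by simpa using hp i) (fun i => by simpa using hv i) (D x) (hDm x)
      (Real.exp (-T)) (Real.exp_pos _).le (by
        intro y hy
        have hy' : T < ∑ i, idens (s i + v i) (v i) (x i) (y i) := hy
        rw [prod_ratio (fun i => s i + v i) v hp hv x y, ← mul_assoc, ← Real.exp_add]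
        refine le_mul_of_one_le_left (Finset.prod_nonneg fun i _ => gaussianPDFReal_nonneg _ _ _) ?_
        rw [Real.one_le_exp_iff]; linarith)
    refine h1.trans ?_
    calc _ ≤ ENNReal.ofReal (Real.exp (-T)) * 1 := by gcongr; exact prob_le_one
      _ = _ := mul_one _
  have hF3 : ∫⁻ x, κ x (D x)ᶜ ∂μ + μ Aᶜ + M * ENNReal.ofReal (Real.exp (-T)) < e := by
    refine lt_of_le_of_lt ?_ H
    gcongr
    · have hSm : MeasurableSet {xy : (Fin l → ℝ) × (Fin l → ℝ) |
          ¬ T < ∑ i, idens (s i + v i) (v i) (xy.1 i) (xy.2 i)} :=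
        (measurableSet_lt measurable_const
          (measurable_sum_idens _ _ (fun z : (Fin l → ℝ) × (Fin l → ℝ) => z.1) (fun z => z.2)
            measurable_fst measurable_snd)).compl
      have := hkey2 _ hSm
      refine (le_of_eq this).trans ?_
      have hc' := info_conc s v hs hv c hc
      rw [Fintype.card_fin] at hc'
      refine (measure_mono ?_).trans hc'
      intro xw hxw
      have hxw' : ¬ T < ∑ i, idens (s i + v i) (v i) (xw.1 i) (xw.1 i + xw.2 i) := hxw
      show c ≤ |_|
      rw [abs_sub_comm]
      refine le_trans ?_ (le_abs_self _)
      linarith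
    · have hc' := cheb_gauss s hs (fun _ => 1) (fun _ => 0) d hd (∑ i, s i ^ 2) (by simp)
      refine (measure_mono ?_).trans hc'
      intro x hx
      have hx' : ¬ ∑ i, x i ^ 2 ≤ l * P := hx
      show d ≤ |_|
      refine le_trans ?_ (le_abs_self _)
      simp only [one_mul, zero_mul, add_zero]
      linarith
  obtain ⟨enc, R, h⟩ := feinstein_s8 μ κ ν D hDm A hAm hF0 hF1 (ENNReal.ofReal (Real.exp (-T))) hF2 e he M hF3
  refine ⟨enc, R, fun u hu => ?_⟩
  obtain ⟨h1, h2, h3, h4, h5⟩ := h u hu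
  refine ⟨?_, ?_, h5⟩
  · have h3' : ∑ i, enc u i ^ 2 ≤ l * P := h3
    unfold powerConstraint
    have : (0:ℝ) < l := by exact_mod_cast hl
    rw [one_div, inv_mul_le_iff₀ this]
    exact h3'
  · rw [Measure.map_apply (by fun_prop) h1.compl] at h4
    exact h4

lemma code_avgError (σ2 : ℕ → ℝ) (l M : ℕ) (hM : 0 < M) (P : ℝ) (e : ℝ≥0∞) (he : e ≤ 1)
    (enc : ℕ → Fin l → ℝ) (R : ℕ → Set (Fin l → ℝ))
    (h : ∀ u < M, powerConstraint P l (enc u) ∧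
      (Measure.pi fun i : Fin l => gaussianReal 0 (σ2 i).toNNReal)
        {w | (fun i => enc u i + w i) ∉ R u} ≤ e ∧ ∀ u' < u, Disjoint (R u') (R u)) :
    ∃ (enc : Fin M → Fin l → ℝ) (dec : (Fin l → ℝ) → Fin M),
      (∀ u, powerConstraint P l (enc u)) ∧ avgError σ2 l M enc dec ≤ e.toReal := by
  classical
  have : Nonempty (Fin M) := ⟨⟨0, hM⟩⟩
  let dec : (Fin l → ℝ) → Fin M := fun y =>
    if hy : ∃ u : Fin M, y ∈ R u then hy.choose else ⟨0, hM⟩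
  have hdec : ∀ (u : Fin M) y, y ∈ R u → dec y = u := by
    intro u y hy
    have hex : ∃ u : Fin M, y ∈ R u := ⟨u, hy⟩
    have hd : dec y = hex.choose := dif_pos hex
    have hc := hex.choose_spec
    rw [hd]
    by_contra hne
    rcases lt_or_gt_of_ne hne with hlt | hlt
    · exact Set.disjoint_left.1 ((h u u.2).2.2 _ hlt) hc hy
    · exact Set.disjoint_left.1 ((h _ hex.choose.2).2.2 _ hlt) hy hc
  refine ⟨fun u => enc u, dec, fun u => (h u u.2).1, ?_⟩
  unfold avgError
  have hMr : (0:ℝ) < M := by exact_mod_cast hM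
  rw [one_div, inv_mul_le_iff₀ hMr]
  calc _ ≤ ∑ u : Fin M, e.toReal := by
        refine Finset.sum_le_sum fun u _ => ?_
        refine ENNReal.toReal_mono (ne_top_of_le_ne_top ENNReal.one_ne_top he) ?_
        refine le_trans (measure_mono ?_) (h u u.2).2.1
        intro w hw hR
        exact hw (hdec u _ hR)
    _ = _ := by simp

theorem ach (σ2 s : ℕ → ℝ) (hσ : ∀ i, 0 < σ2 i) (hs : ∀ i, 0 ≤ s i) (B : ℝ) (hB : ∀ i, s i ≤ B)
    (P A R : ℝ) (hAP : A < P) (hA : ∀ᶠ l : ℕ in atTop, ∑ i ∈ Finset.range l, s i ≤ l * A)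
    (hR : ∀ᶠ l : ℕ in atTop, l * R ≤
      ∑ i ∈ Finset.range l, Real.log ((s i + σ2 i) / σ2 i) / 2) (hP : 0 < P) :
    IsAchievableRate σ2 P (R / Real.log 2) := by
  intro η₁ hη₁ η₂ hη₂
  have hlog2 : 0 < Real.log 2 := Real.log_pos (by norm_num)
  by_cases hsmall : R / Real.log 2 ≤ η₂
  · refine ⟨0, fun l hl => ⟨1, fun _ _ => 0, fun _ => 0, fun u => ?_, ?_, ?_⟩⟩
    · simp [powerConstraint, hP.le]
    · have : ∀ (u : Fin 1), ({w : Fin l → ℝ | (0 : Fin 1) ≠ u} : Set _) = ∅ := by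
        intro u; ext w; simp [Subsingleton.elim u 0]
      simp only [avgError, this]
      simpa using hη₁
    · simp; linarith
  push Not at hsmall
  set ρ := R - η₂ * Real.log 2 with hρ
  have hρ0 : 0 < ρ := by
    rw [lt_div_iff₀ hlog2] at hsmall; linarith
  set g := η₂ * Real.log 2 / 3 with hg
  have hg0 : 0 < g := by positivity
  set δ := P - A with hδ
  have hδ0 : 0 < δ := by simp [hδ, hAP]
  have hB0 : 0 ≤ B := (hs 0).trans (hB 0)
  have hK := gaussK_nonneg
  set e : ℝ := min (η₁ / 2) 1 with he
  have he0 : 0 < e := by positivity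
  -- the error bound as a function of l
  have hlim : Tendsto (fun l : ℕ => 2 * gaussK / g ^ 2 * (l : ℝ)⁻¹ + gaussK * B ^ 2 / δ ^ 2 * (l : ℝ)⁻¹
      + 2 * Real.exp (-g * l)) atTop (𝓝 0) := by
    have h1 : Tendsto (fun l : ℕ => (l : ℝ)⁻¹) atTop (𝓝 0) := tendsto_inv_atTop_nhds_zero_nat
    have h2 : Tendsto (fun l : ℕ => Real.exp (-g * l)) atTop (𝓝 0) := by
      refine Real.tendsto_exp_atBot.comp ?_
      exact (tendsto_natCast_atTop_atTop).const_mul_atTop_of_neg (by linarith)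
    simpa using ((h1.const_mul (2 * gaussK / g ^ 2)).add (h1.const_mul (gaussK * B ^ 2 / δ ^ 2))).add
      (h2.const_mul 2)
  have hev := hA.and (hR.and ((hlim.eventually_lt_const he0).and (eventually_gt_atTop 0)))
  obtain ⟨l₀, hl₀⟩ := eventually_atTop.1 hev
  refine ⟨l₀, fun l hl => ?_⟩
  obtain ⟨hAl, hRl, hEl, hlpos⟩ := hl₀ l (le_of_lt hl)
  have hlr : (0:ℝ) < l := by exact_mod_cast hlpos
  set M : ℕ := ⌈Real.exp (l * ρ)⌉₊ with hM
  have hMpos : 0 < M := Nat.ceil_pos.2 (Real.exp_pos _)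
  have hMge : Real.exp (l * ρ) ≤ M := Nat.le_ceil _
  have hMle : (M : ℝ) ≤ 2 * Real.exp (l * ρ) := by
    have h1 := (Nat.ceil_lt_add_one (Real.exp_pos (l * ρ)).le).le
    have h2 : 1 ≤ Real.exp (l * ρ) := Real.one_le_exp (by positivity)
    linarith
  obtain ⟨enc, Rg, hcode⟩ := code_core l hlpos (fun i => s i) (fun i => σ2 i) (fun i => hs i)
    (fun i => hσ i) (l * (ρ + g)) (l * g) P (l * δ) (by positivity) (by
      rw [Fin.sum_univ_eq_sum_range (fun i => Real.log ((s i + σ2 i) / σ2 i) / 2) l]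
      refine le_trans ?_ hRl
      rw [← mul_add]
      refine mul_le_mul_of_nonneg_left ?_ hlr.le
      simp only [hρ, hg]; nlinarith) (by positivity) (by
      rw [Fin.sum_univ_eq_sum_range (fun i => s i) l]
      simp only [hδ]; nlinarith) M (ENNReal.ofReal e) (by
        rw [← ENNReal.ofReal_one]; exact ENNReal.ofReal_le_ofReal (min_le_right _ _)) (by
      have hsum : ∑ i : Fin l, s i ^ 2 ≤ l * B ^ 2 := by
        calc _ ≤ ∑ i : Fin l, B ^ 2 := Finset.sum_le_sum fun i _ =>
              pow_le_pow_left₀ (hs i) (hB i) 2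
          _ = _ := by simp
      have hsum0 : 0 ≤ ∑ i : Fin l, s i ^ 2 := Finset.sum_nonneg fun i _ => sq_nonneg _
      rw [← ENNReal.ofReal_natCast M, ← ENNReal.ofReal_mul (by positivity),
        ← ENNReal.ofReal_add (by positivity) (by positivity),
        ← ENNReal.ofReal_add (by positivity) (by positivity)]
      rw [ENNReal.ofReal_lt_ofReal_iff he0]
      refine lt_of_le_of_lt ?_ hEl
      gcongr ?_ + ?_ + ?_
      · refine le_of_eq ?_
        field_simp
      · calc _ ≤ gaussK * (l * B ^ 2) / (l * δ) ^ 2 := by gcongr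
          _ = _ := by field_simp
      · calc _ ≤ 2 * Real.exp (l * ρ) * Real.exp (-(l * (ρ + g))) := by gcongr
          _ = _ := by rw [mul_assoc, ← Real.exp_add]; ring_nf)
  obtain ⟨enc', dec', h1, h2⟩ := code_avgError σ2 l M hMpos P (ENNReal.ofReal e) (by
    rw [← ENNReal.ofReal_one]; exact ENNReal.ofReal_le_ofReal (min_le_right _ _)) enc Rg hcode
  refine ⟨M, enc', dec', h1, ?_, ?_⟩
  · refine lt_of_le_of_lt h2 ?_
    rw [ENNReal.toReal_ofReal he0.le]
    exact lt_of_le_of_lt (min_le_left _ _) (by linarith)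
  · rw [ge_iff_le, le_div_iff₀ hlr, Real.logb, le_div_iff₀ hlog2]
    have : l * ρ ≤ Real.log M := by
      rw [Real.le_log_iff_exp_le (by exact_mod_cast hMpos)]; exact hMge
    refine le_trans (le_of_eq ?_) this
    rw [hρ]; field_simp

lemma conv_tail (l : ℕ) (v : Fin l → ℝ) (hv : ∀ i, 0 < v i) (Δ P c T : ℝ)
    (hΔ : 0 < Δ) (hc : 0 < c) (x : Fin l → ℝ) (hx : ∑ i, x i ^ 2 ≤ l * P)
    (hT : ∑ i, (Real.log (max Δ (v i) / v i) / 2 + (P - max (Δ - v i) 0) / (2 * Δ)) + c ≤ T) :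
    (Measure.pi fun i => gaussianReal 0 (v i).toNNReal)
      {w | T ≤ ∑ i, idens (max Δ (v i)) (v i) (x i) (x i + w i)} ≤
      ENNReal.ofReal (gaussK * (l * (1 / 4 + P / Δ)) / c ^ 2) := by
  have hτ : ∀ i, 0 < max Δ (v i) := fun i => lt_max_of_lt_left hΔ
  have h := cheb_gauss v (fun i => (hv i).le) (fun i => 1 / (2 * max Δ (v i)) - 1 / (2 * v i))
    (fun i => x i / max Δ (v i)) c hc (l * (1 / 4 + P / Δ)) (by
      calc _ ≤ ∑ i, (1 / 4 + x i ^ 2 / Δ) := by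
            refine Finset.sum_le_sum fun i _ => add_le_add ?_ ?_
            · have h1 := hτ i
              have h2 := hv i
              have h3 : v i / max Δ (v i) ≤ 1 := (div_le_one h1).2 (le_max_right _ _)
              have h4 : 0 ≤ v i / max Δ (v i) := by positivity
              have : (1 / (2 * max Δ (v i)) - 1 / (2 * v i)) ^ 2 * v i ^ 2
                = (1 - v i / max Δ (v i)) ^ 2 / 4 := by field_simp; ring
              rw [this]
              nlinarith
            · have h1 := hτ i
              have h2 := hv i
              have h3 : v i / max Δ (v i) ≤ 1 := (div_le_one h1).2 (le_max_right _ _)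
              calc (x i / max Δ (v i)) ^ 2 * v i = x i ^ 2 / max Δ (v i) * (v i / max Δ (v i)) := by
                    field_simp
                _ ≤ x i ^ 2 / max Δ (v i) * 1 := by gcongr
                _ ≤ x i ^ 2 / Δ := by
                  rw [mul_one]; gcongr; exact le_max_left _ _
        _ ≤ _ := by
            rw [Finset.sum_add_distrib, ← Finset.sum_div]
            simp only [Finset.sum_const, Finset.card_univ, Fintype.card_fin, nsmul_eq_mul]
            rw [mul_add]
            have := div_le_div_of_nonneg_right hx hΔ.le
            rw [mul_div_assoc, Finset.sum_div] at this
            rw [mul_div_assoc]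
            linarith)
  refine (measure_mono ?_).trans h
  intro w hw
  have hw' : T ≤ ∑ i, idens (max Δ (v i)) (v i) (x i) (x i + w i) := hw
  show c ≤ |_|
  refine le_trans ?_ (le_abs_self _)
  have e1 : ∑ i, idens (max Δ (v i)) (v i) (x i) (x i + w i) =
      ∑ i, (Real.log (max Δ (v i) / v i) / 2 + x i ^ 2 / (2 * max Δ (v i))) +
      ∑ i, ((1 / (2 * max Δ (v i)) - 1 / (2 * v i)) * w i ^ 2 + x i / max Δ (v i) * w i) := by
    rw [← Finset.sum_add_distrib]
    refine Finset.sum_congr rfl fun i _ => ?_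
    have h1 := hτ i
    have h2 := hv i
    rw [idens]; field_simp; ring
  have e2 : ∑ i, (Real.log (max Δ (v i) / v i) / 2 + x i ^ 2 / (2 * max Δ (v i))) +
      ∑ i, (1 / (2 * max Δ (v i)) - 1 / (2 * v i)) * v i ≤
      ∑ i, (Real.log (max Δ (v i) / v i) / 2 + (P - max (Δ - v i) 0) / (2 * Δ)) := by
    have e3 : ∀ i, (Real.log (max Δ (v i) / v i) / 2 + x i ^ 2 / (2 * max Δ (v i))) +
        (1 / (2 * max Δ (v i)) - 1 / (2 * v i)) * v i ≤
        (Real.log (max Δ (v i) / v i) / 2 + (P - max (Δ - v i) 0) / (2 * Δ)) +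
          (x i ^ 2 - P) / (2 * Δ) := by
      intro i
      have h2 := hv i
      rcases le_total (v i) Δ with h | h
      · rw [max_eq_left h, max_eq_left (sub_nonneg.2 h)]
        refine le_of_eq ?_
        field_simp; ring
      · rw [max_eq_right h, max_eq_right (sub_nonpos.2 h)]
        have : x i ^ 2 / (2 * v i) ≤ x i ^ 2 / (2 * Δ) := by gcongr
        have h5 : (1 / (2 * v i) - 1 / (2 * v i)) * v i = 0 := by ring
        have h6 : (P - 0) / (2 * Δ) + (x i ^ 2 - P) / (2 * Δ) = x i ^ 2 / (2 * Δ) := by ring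
        linarith
    have e4 : ∑ i, (x i ^ 2 - P) / (2 * Δ) ≤ 0 := by
      rw [← Finset.sum_div]
      refine div_nonpos_of_nonpos_of_nonneg ?_ (by positivity)
      rw [Finset.sum_sub_distrib]
      simp only [Finset.sum_const, Finset.card_univ, Fintype.card_fin, nsmul_eq_mul]
      linarith
    have := Finset.sum_le_sum fun i (_ : i ∈ Finset.univ) => e3 i
    rw [Finset.sum_add_distrib, Finset.sum_add_distrib (g := fun i => (x i ^ 2 - P) / (2 * Δ))] at this
    linarith
  rw [e1] at hw'
  linarith

lemma conv_core (σ2 : ℕ → ℝ) (hσ : ∀ i, 0 < σ2 i) (l M : ℕ) (hl : 0 < l) (hM : 0 < M) (Δ P c T : ℝ)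
    (hΔ : 0 < Δ) (hc : 0 < c) (hP : 0 < P) (enc : Fin M → Fin l → ℝ) (dec : (Fin l → ℝ) → Fin M)
    (hpow : ∀ u, powerConstraint P l (enc u))
    (hT : ∑ i ∈ Finset.range l, (Real.log (max Δ (σ2 i) / σ2 i) / 2 +
      (P - max (Δ - σ2 i) 0) / (2 * Δ)) + c ≤ T) :
    M * (1 - avgError σ2 l M enc dec - gaussK * (l * (1 / 4 + P / Δ)) / c ^ 2) ≤ Real.exp T := by
  set v : Fin l → ℝ := fun i => σ2 i with hv
  have hvpos : ∀ i, 0 < v i := fun i => hσ i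
  have hτ : ∀ i, 0 < max Δ (v i) := fun i => lt_max_of_lt_left hΔ
  set N := noiseMeasure σ2 l with hN
  have hN' : N = Measure.pi fun i => gaussianReal 0 (v i).toNNReal := rfl
  have hNp : IsProbabilityMeasure N := by rw [hN']; infer_instance
  set ν := Measure.pi fun i => gaussianReal 0 (max Δ (v i)).toNNReal with hν
  set δ := gaussK * (l * (1 / 4 + P / Δ)) / c ^ 2 with hδ
  have hδ0 : 0 ≤ δ := by have := gaussK_nonneg; positivity
  let E : Fin M → Set (Fin l → ℝ) := fun u => {w | dec (fun i => enc u i + w i) ≠ u}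
  let D : Fin M → Set (Fin l → ℝ) := fun u => {y | (fun i => y i - enc u i) ∈ (toMeasurable N (E u))ᶜ}
  have hDm : ∀ u, MeasurableSet (D u) := fun u =>
    (show Measurable fun (y : Fin l → ℝ) i => y i - enc u i by fun_prop)
      (measurableSet_toMeasurable N (E u)).compl
  have hDdec : ∀ u y, y ∈ D u → dec y = u := by
    intro u y hy
    by_contra hne
    refine hy (subset_toMeasurable N (E u) ?_)
    show dec (fun i => enc u i + (y i - enc u i)) ≠ u
    simpa using hne
  have hDdisj : Set.PairwiseDisjoint (↑(Finset.univ : Finset (Fin M))) D := by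
    intro u _ u' _ hne
    refine Set.disjoint_left.2 fun y hy hy' => hne ?_
    rw [← hDdec u y hy, ← hDdec u' y hy']
  have hνsum : ∑ u, ν (D u) ≤ 1 := by
    rw [← measure_biUnion_finset hDdisj (fun u _ => hDm u)]
    exact prob_le_one
  have hνsum' : ∑ u, (ν (D u)).toReal ≤ 1 := by
    rw [← ENNReal.toReal_sum (fun u _ => measure_ne_top _ _)]
    exact ENNReal.toReal_le_of_le_ofReal zero_le_one (by simpa using hνsum)
  have hu : ∀ u, 1 - (N (E u)).toReal ≤ δ + Real.exp T * (ν (D u)).toReal := by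
    intro u
    have hpre : (fun (w : Fin l → ℝ) i => enc u i + w i) ⁻¹' (D u) = (toMeasurable N (E u))ᶜ := by
      ext w
      show (fun i => (enc u i + w i) - enc u i) ∈ (toMeasurable N (E u))ᶜ ↔ _
      simp
    have hA : 1 - (N (E u)).toReal = (N ((fun (w : Fin l → ℝ) i => enc u i + w i) ⁻¹' (D u))).toReal := by
      rw [hpre, ← measureReal_def, ← measureReal_def, probReal_compl_eq_one_sub
        (measurableSet_toMeasurable N (E u)), measureReal_def, measureReal_def, measure_toMeasurable]
    rw [hA]
    have hSm : MeasurableSet {y : Fin l → ℝ | T ≤ ∑ i, idens (max Δ (v i)) (v i) (enc u i) (y i)} :=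
      measurableSet_le measurable_const
        (measurable_sum_idens _ _ (fun _ => enc u) (fun y => y) measurable_const measurable_id)
    set S := {y : Fin l → ℝ | T ≤ ∑ i, idens (max Δ (v i)) (v i) (enc u i) (y i)} with hS
    have hb1 : N ((fun (w : Fin l → ℝ) i => enc u i + w i) ⁻¹' S) ≤ ENNReal.ofReal δ := by
      refine conv_tail l v hvpos Δ P c T hΔ hc (enc u) ?_ ?_
      · have := hpow u
        unfold powerConstraint at this
        have hlr : (0:ℝ) < l := by exact_mod_cast hl
        rwa [one_div, inv_mul_le_iff₀ hlr] at this
      · rw [← Fin.sum_univ_eq_sum_range (fun i => (Real.log (max Δ (σ2 i) / σ2 i) / 2 +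
          (P - max (Δ - σ2 i) 0) / (2 * Δ))) l] at hT
        exact hT
    have hb2 : N ((fun (w : Fin l → ℝ) i => enc u i + w i) ⁻¹' (D u \ S)) ≤
        ENNReal.ofReal (Real.exp T) * ν (D u) := by
      have hm := (hDm u).diff hSm
      rw [← Measure.map_apply (by fun_prop) hm, hN', noise_shift (enc u) (fun i => (v i).toNNReal)]
      refine (pi_gauss_le (enc u) (fun _ => 0) (fun i => (v i).toNNReal)
        (fun i => (max Δ (v i)).toNNReal) (fun i => by simpa using hvpos i)
        (fun i => (Real.toNNReal_pos.2 (hτ i)).ne') _ hm (Real.exp T) (Real.exp_pos _).le ?_).trans ?_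
      · intro y hy
        have hy' : ¬ T ≤ ∑ i, idens (max Δ (v i)) (v i) (enc u i) (y i) := hy.2
        rw [prod_ratio (fun i => max Δ (v i)) v hτ hvpos (enc u) y]
        refine mul_le_mul_of_nonneg_right ?_ (Finset.prod_nonneg fun i _ => gaussianPDFReal_nonneg _ _ _)
        exact Real.exp_le_exp.2 (not_le.1 hy').le
      · gcongr
        exact Set.sdiff_subset
    have hb3 : N ((fun (w : Fin l → ℝ) i => enc u i + w i) ⁻¹' (D u)) ≤
        ENNReal.ofReal δ + ENNReal.ofReal (Real.exp T) * ν (D u) := by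
      refine le_trans (measure_mono ?_) ((measure_union_le _ _).trans (add_le_add hb1 hb2))
      intro w hw
      by_cases h : (fun i => enc u i + w i) ∈ S
      · exact Or.inl h
      · exact Or.inr ⟨hw, h⟩
    have := ENNReal.toReal_mono (by finiteness) hb3
    rwa [ENNReal.toReal_add (by finiteness) (by finiteness), ENNReal.toReal_mul,
      ENNReal.toReal_ofReal hδ0, ENNReal.toReal_ofReal (Real.exp_pos _).le] at this
  have hsum := Finset.sum_le_sum fun u (_ : u ∈ Finset.univ) => hu u
  rw [Finset.sum_sub_distrib, Finset.sum_add_distrib, ← Finset.mul_sum] at hsum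
  simp only [Finset.sum_const, Finset.card_univ, Fintype.card_fin, nsmul_eq_mul, mul_one] at hsum
  have hMr : (0:ℝ) < M := by exact_mod_cast hM
  have havg : (M:ℝ) * avgError σ2 l M enc dec = ∑ u, (N (E u)).toReal := by
    unfold avgError
    rw [← mul_assoc, mul_one_div_cancel hMr.ne', one_mul]
  have : Real.exp T * ∑ u, (ν (D u)).toReal ≤ Real.exp T :=
    mul_le_of_le_one_right (Real.exp_pos _).le hνsum'
  calc (M:ℝ) * (1 - avgError σ2 l M enc dec - δ) = M - M * avgError σ2 l M enc dec - M * δ := by ring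
    _ ≤ _ := by rw [havg]; linarith

theorem conv (σ2 : ℕ → ℝ) (hσ : ∀ i, 0 < σ2 i) (Δ P G : ℝ) (hΔ : 0 < Δ) (hP : 0 < P)
    (hG : ∀ᶠ l : ℕ in atTop, ∑ i ∈ Finset.range l, (Real.log (max Δ (σ2 i) / σ2 i) / 2 +
      (P - max (Δ - σ2 i) 0) / (2 * Δ)) ≤ l * G) (R : ℝ) (hR : IsAchievableRate σ2 P R) :
    R ≤ G / Real.log 2 := by
  have hlog2 : 0 < Real.log 2 := Real.log_pos (by norm_num)
  by_contra hcon
  push Not at hcon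
  rw [div_lt_iff₀ hlog2] at hcon
  set γ := (R * Real.log 2 - G) / 4 with hγ
  have hγ0 : 0 < γ := by rw [hγ]; linarith
  obtain ⟨l₀, h⟩ := hR (1 / 4) (by norm_num) (γ / Real.log 2) (by positivity)
  have h1 : Tendsto (fun l : ℕ => (l : ℝ)⁻¹) atTop (𝓝 0) := tendsto_inv_atTop_nhds_zero_nat
  have ht1 : Tendsto (fun l : ℕ => gaussK * (1 / 4 + P / Δ) / γ ^ 2 * (l : ℝ)⁻¹) atTop (𝓝 0) := by
    simpa using h1.const_mul (gaussK * (1 / 4 + P / Δ) / γ ^ 2)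
  have ht2 : Tendsto (fun l : ℕ => Real.log 2 * (l : ℝ)⁻¹) atTop (𝓝 0) := by
    simpa using h1.const_mul (Real.log 2)
  obtain ⟨l, hGl, hl1, hl2, hl3, hl4⟩ := (hG.and ((ht1.eventually_lt_const (show (0:ℝ) < 1 / 4 by norm_num)).and
    ((ht2.eventually_lt_const hγ0).and ((eventually_gt_atTop l₀).and (eventually_gt_atTop 0))))).exists
  obtain ⟨M, enc, dec, hpow, herr, hrate⟩ := h l hl3
  have hlr : (0:ℝ) < l := by exact_mod_cast hl4
  have hM : 0 < M := Fin.pos (dec 0)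
  have hMr : (0:ℝ) < M := by exact_mod_cast hM
  have hcore := conv_core σ2 hσ l M hl4 hM Δ P (l * γ) (l * (G + γ)) hΔ (by positivity) hP enc dec hpow
    (by rw [mul_add]; linarith)
  have e1 : gaussK * (l * (1 / 4 + P / Δ)) / (l * γ) ^ 2 = gaussK * (1 / 4 + P / Δ) / γ ^ 2 * (l : ℝ)⁻¹ := by
    field_simp
  rw [e1] at hcore
  have hM2 : (M:ℝ) ≤ 2 * Real.exp (l * (G + γ)) := by nlinarith
  have hlogM : Real.log M ≤ Real.log 2 + l * (G + γ) := by
    rw [← Real.log_exp (l * (G + γ)), ← Real.log_mul (by norm_num) (Real.exp_pos _).ne']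
    exact Real.log_le_log hMr hM2
  rw [ge_iff_le, le_div_iff₀ hlr, Real.logb, le_div_iff₀ hlog2] at hrate
  have e2 : (R - γ / Real.log 2) * l * Real.log 2 = l * (G + 3 * γ) := by
    rw [hγ]; field_simp; ring
  rw [e2] at hrate
  have e3 : Real.log 2 < γ * l := by
    rwa [← div_eq_mul_inv, div_lt_iff₀ hlr] at hl2
  nlinarith

section Weyl
variable {T : ℝ} [hT : Fact (0 < T)]

/-- Weyl's equidistribution for trigonometric monomials, uniformly near the rotation. -/
lemma weyl_mono (x : AddCircle T) (hx : ∀ n : ℤ, n ≠ 0 → n • x ≠ 0) (k : ℤ) :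
    Tendsto (fun q : ℕ × AddCircle T => (q.1 : ℂ)⁻¹ * ∑ i ∈ Finset.range q.1, fourier k (i • q.2))
      (atTop ×ˢ 𝓝 x) (𝓝 (∫ y : AddCircle T, fourier k y ∂AddCircle.haarAddCircle)) := by
  rcases eq_or_ne k 0 with rfl | hk
  · have e : ∫ y : AddCircle T, fourier 0 y ∂AddCircle.haarAddCircle = 1 := by
      simp [fourier_zero]
    rw [e]
    refine Tendsto.congr' ?_ tendsto_const_nhds
    have : ∀ᶠ q : ℕ × AddCircle T in atTop ×ˢ 𝓝 x, 0 < q.1 :=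
      tendsto_fst.eventually (eventually_gt_atTop 0)
    filter_upwards [this] with q hq
    have : (q.1 : ℂ) ≠ 0 := by exact_mod_cast hq.ne'
    simp [fourier_zero, this]
  · have e : ∫ y : AddCircle T, fourier k y ∂AddCircle.haarAddCircle = 0 :=
      integral_eq_zero_of_add_right_eq_neg (μ := AddCircle.haarAddCircle)
        (fourier_add_half_inv_index hk hT.out)
    rw [e]
    have hne : fourier k x ≠ 1 := by
      rw [fourier_apply]
      intro h
      have h1 : AddCircle.toCircle (k • x) = AddCircle.toCircle (0 : AddCircle T) := by
        rw [AddCircle.toCircle_zero]; exact Subtype.ext h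
      exact hx k hk (AddCircle.injective_toCircle hT.out.ne' h1)
    have hpow : ∀ (i : ℕ) (y : AddCircle T), fourier k (i • y) = (fourier k y) ^ i := by
      intro i y
      rw [fourier_apply, fourier_apply, smul_comm, AddCircle.toCircle_nsmul]
      simp
    have hcont : Tendsto (fun q : ℕ × AddCircle T => ‖fourier k q.2 - 1‖) (atTop ×ˢ 𝓝 x)
        (𝓝 ‖fourier k x - 1‖) := by
      have : Continuous fun y : AddCircle T => ‖fourier k y - 1‖ := by fun_prop
      exact (this.tendsto x).comp tendsto_snd
    have hpos : 0 < ‖fourier k x - 1‖ := norm_pos_iff.2 (sub_ne_zero.2 hne)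
    have hb : Tendsto (fun q : ℕ × AddCircle T => (q.1 : ℝ)⁻¹ * (2 / ‖fourier k q.2 - 1‖))
        (atTop ×ˢ 𝓝 x) (𝓝 (0 * (2 / ‖fourier k x - 1‖))) := by
      refine Tendsto.mul ?_ (tendsto_const_nhds.div hcont hpos.ne')
      exact (tendsto_inv_atTop_zero.comp tendsto_natCast_atTop_atTop).comp tendsto_fst
    rw [zero_mul] at hb
    refine squeeze_zero_norm' ?_ hb
    have hev := hcont.eventually (lt_mem_nhds hpos)
    filter_upwards [hev] with q hq
    have hne' : fourier k q.2 ≠ 1 := sub_ne_zero.1 (norm_pos_iff.1 hq)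
    simp_rw [hpow]
    rw [geom_sum_eq hne', norm_mul, norm_inv, norm_div, Complex.norm_natCast]
    gcongr
    refine (norm_sub_le _ _).trans ?_
    rw [norm_pow]
    have : ‖(fourier k q.2 : ℂ)‖ = 1 := by rw [fourier_apply]; exact Circle.norm_coe _
    rw [this]; norm_num

lemma weyl_cplx (x : AddCircle T) (hx : ∀ n : ℤ, n ≠ 0 → n • x ≠ 0) (g : C(AddCircle T, ℂ)) :
    Tendsto (fun q : ℕ × AddCircle T => (q.1 : ℂ)⁻¹ * ∑ i ∈ Finset.range q.1, g (i • q.2))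
      (atTop ×ˢ 𝓝 x) (𝓝 (∫ y, g y ∂AddCircle.haarAddCircle)) := by
  have hInteg : ∀ f : C(AddCircle T, ℂ), Integrable (fun y => f y) AddCircle.haarAddCircle := fun f =>
    f.continuous.integrable_of_hasCompactSupport (HasCompactSupport.of_compactSpace _)
  have hspan : ∀ f ∈ Submodule.span ℂ (Set.range (@fourier T)),
      Tendsto (fun q : ℕ × AddCircle T => (q.1 : ℂ)⁻¹ * ∑ i ∈ Finset.range q.1, f (i • q.2))
      (atTop ×ˢ 𝓝 x) (𝓝 (∫ y, f y ∂AddCircle.haarAddCircle)) := by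
    intro f hf
    induction hf using Submodule.span_induction with
    | mem f h => obtain ⟨k, rfl⟩ := h; exact weyl_mono x hx k
    | zero => simp
    | add f g _ _ h1 h2 =>
      have := h1.add h2
      rw [← integral_add (hInteg f) (hInteg g)] at this
      simpa [Finset.sum_add_distrib, mul_add] using this
    | smul a f _ h =>
      have := h.const_mul a
      rw [← integral_const_mul] at this
      refine this.congr fun q => ?_
      simp only [ContinuousMap.smul_apply, smul_eq_mul, ← Finset.mul_sum]; ring
  have hg : g ∈ (Submodule.span ℂ (Set.range (@fourier T))).topologicalClosure := by
    rw [span_fourier_closure_eq_top]; trivial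
  rw [← SetLike.mem_coe, Submodule.topologicalClosure_coe, Metric.mem_closure_iff] at hg
  rw [Metric.tendsto_nhds]
  intro η hη
  obtain ⟨f, hf, hfg⟩ := hg (η / 3) (by positivity)
  have h1 := Metric.tendsto_nhds.1 (hspan f hf) (η / 3) (by positivity)
  have hpt : ∀ y, ‖g y - f y‖ ≤ η / 3 := fun y => by
    rw [← dist_eq_norm]; exact (ContinuousMap.dist_apply_le_dist y).trans hfg.le
  filter_upwards [h1] with q hq
  have h2 : dist ((q.1 : ℂ)⁻¹ * ∑ i ∈ Finset.range q.1, g (i • q.2))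
      ((q.1 : ℂ)⁻¹ * ∑ i ∈ Finset.range q.1, f (i • q.2)) ≤ η / 3 := by
    rw [dist_eq_norm, ← mul_sub, ← Finset.sum_sub_distrib, norm_mul, norm_inv,
      Complex.norm_natCast]
    have : ‖∑ i ∈ Finset.range q.1, (g (i • q.2) - f (i • q.2))‖ ≤ q.1 * (η / 3) := by
      refine (norm_sum_le _ _).trans ((Finset.sum_le_sum fun i _ => hpt _).trans ?_)
      simp
    rcases Nat.eq_zero_or_pos q.1 with h | h
    · rw [h]; simp; positivity
    · have hq' : (0:ℝ) < q.1 := by exact_mod_cast h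
      rwa [inv_mul_le_iff₀ hq']
  have h3 : dist (∫ y, f y ∂AddCircle.haarAddCircle) (∫ y, g y ∂AddCircle.haarAddCircle) ≤ η / 3 := by
    rw [dist_comm, dist_eq_norm, ← integral_sub (hInteg g) (hInteg f)]
    refine (norm_integral_le_of_norm_le_const (C := η / 3) (ae_of_all _ hpt)).trans ?_
    simp
  have h4 := dist_triangle4 ((q.1 : ℂ)⁻¹ * ∑ i ∈ Finset.range q.1, g (i • q.2))
    ((q.1 : ℂ)⁻¹ * ∑ i ∈ Finset.range q.1, f (i • q.2))
    (∫ y, f y ∂AddCircle.haarAddCircle) (∫ y, g y ∂AddCircle.haarAddCircle)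
  linarith

/-- Integral over the circle. -/
noncomputable def cint (T : ℝ) [Fact (0 < T)] (g : AddCircle T → ℝ) : ℝ :=
  ∫ y, g y ∂AddCircle.haarAddCircle

lemma weyl_real (x : AddCircle T) (hx : ∀ n : ℤ, n ≠ 0 → n • x ≠ 0) (g : AddCircle T → ℝ)
    (hg : Continuous g) :
    Tendsto (fun q : ℕ × AddCircle T => (q.1 : ℝ)⁻¹ * ∑ i ∈ Finset.range q.1, g (i • q.2))
      (atTop ×ˢ 𝓝 x) (𝓝 (cint T g)) := by
  have h := weyl_cplx x hx ⟨fun y => (g y : ℂ), by fun_prop⟩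
  have h2 := (Complex.continuous_re.tendsto _).comp h
  have e : (∫ y, ((g y : ℝ) : ℂ) ∂AddCircle.haarAddCircle) = ((cint T g : ℝ) : ℂ) :=
    integral_ofReal
  simp only [ContinuousMap.coe_mk] at h2
  rw [e, Complex.ofReal_re] at h2
  refine h2.congr fun q => ?_
  simp only [Function.comp, ← Complex.ofReal_sum, ← Complex.ofReal_natCast, ← Complex.ofReal_inv,
    ← Complex.ofReal_mul, Complex.ofReal_re]

/-- For rotations near `x`, the long-run averages are eventually close to the integral. -/
lemma weyl_near (x : AddCircle T) (hx : ∀ n : ℤ, n ≠ 0 → n • x ≠ 0) (g : AddCircle T → ℝ)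
    (hg : Continuous g) (η : ℝ) (hη : 0 < η) :
    ∀ᶠ y in 𝓝 x, ∀ᶠ l : ℕ in atTop,
      |∑ i ∈ Finset.range l, g (i • y) - l * cint T g| ≤ l * η := by
  have h := Metric.tendsto_nhds.1 (weyl_real x hx g hg) η hη
  rw [prod_comm, eventually_map] at h
  have h2 := h.curry
  filter_upwards [h2] with y hy
  filter_upwards [hy, eventually_gt_atTop 0] with l hl hl0
  have hl' : (0:ℝ) < l := by exact_mod_cast hl0
  simp only [Prod.swap] at hl
  rw [Real.dist_eq] at hl
  have : ∑ i ∈ Finset.range l, g (i • y) - l * cint T g =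
    l * ((l : ℝ)⁻¹ * ∑ i ∈ Finset.range l, g (i • y) - cint T g) := by field_simp
  rw [this, abs_mul, abs_of_pos hl']
  gcongr

end Weyl

section Cap
variable {T : ℝ} [hT : Fact (0 < T)]

/-- water-filling power -/
noncomputable def wfa (c : AddCircle T → ℝ) (Δ : ℝ) (y : AddCircle T) : ℝ := max (Δ - c y) 0
/-- water-filling rate -/
noncomputable def wfr (c : AddCircle T → ℝ) (Δ : ℝ) (y : AddCircle T) : ℝ :=
  Real.log (max Δ (c y) / c y) / 2

lemma wfa_cont2 (c : AddCircle T → ℝ) (hc : Continuous c) :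
    Continuous (Function.uncurry (wfa c)) := by
  unfold wfa Function.uncurry; fun_prop

lemma wfr_cont2 (c : AddCircle T → ℝ) (hc : Continuous c) (hpos : ∀ y, 0 < c y) :
    Continuous (Function.uncurry (wfr c)) := by
  unfold wfr Function.uncurry
  have h1 : Continuous fun q : ℝ × AddCircle T => max q.1 (c q.2) / c q.2 :=
    Continuous.div (by fun_prop) (by fun_prop) fun q => (hpos q.2).ne'
  exact (h1.log fun q => (div_pos (lt_max_of_lt_right (hpos _)) (hpos _)).ne').div_const 2

lemma wfa_cont (c : AddCircle T → ℝ) (hc : Continuous c) (Δ : ℝ) : Continuous (wfa c Δ) :=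
  (wfa_cont2 c hc).comp (by fun_prop : Continuous fun y : AddCircle T => (Δ, y))

lemma wfr_cont (c : AddCircle T → ℝ) (hc : Continuous c) (hpos : ∀ y, 0 < c y) (Δ : ℝ) :
    Continuous (wfr c Δ) :=
  (wfr_cont2 c hc hpos).comp (by fun_prop : Continuous fun y : AddCircle T => (Δ, y))

lemma cint_cont (f : ℝ → AddCircle T → ℝ) (hf : Continuous (Function.uncurry f)) :
    Continuous fun Δ => cint T (f Δ) := by
  unfold cint
  have := continuous_parametric_integral_of_continuous (μ := AddCircle.haarAddCircle (T := T)) hf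
    (s := Set.univ) isCompact_univ
  simpa using this

lemma circ_integrable (f : AddCircle T → ℝ) (hf : Continuous f) :
    Integrable f AddCircle.haarAddCircle :=
  hf.integrable_of_hasCompactSupport (HasCompactSupport.of_compactSpace _)

lemma cint_mono (f g : AddCircle T → ℝ) (hf : Continuous f) (hg : Continuous g)
    (h : ∀ y, f y ≤ g y) : cint T f ≤ cint T g :=
  integral_mono (circ_integrable f hf) (circ_integrable g hg) h

lemma level_exists (c : AddCircle T → ℝ) (hc : Continuous c) (hpos : ∀ y, 0 < c y) (P : ℝ)
    (hP : 0 < P) : ∃ Δ > 0, cint T (wfa c Δ) = P := by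
  obtain ⟨B, hB⟩ := isCompact_univ.bddAbove_image (f := c) hc.continuousOn
  have hB' : ∀ y, c y ≤ B := fun y => hB ⟨y, trivial, rfl⟩
  have h0 : cint T (wfa c 0) = 0 := by
    have : wfa c 0 = fun _ => 0 := by
      funext y; unfold wfa; rw [max_eq_right]; linarith [hpos y]
    rw [this]; simp [cint]
  have hBpos : 0 < B := (hpos 0).trans_le (hB' 0)
  have h1 : P ≤ cint T (wfa c (P + B)) := by
    have := cint_mono (fun _ => P) (wfa c (P + B)) continuous_const (wfa_cont c hc _)
      (fun y => le_max_of_le_left (by linarith [hB' y]))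
    simpa [cint] using this
  obtain ⟨Δ, hΔ, e⟩ := intermediate_value_Icc (by linarith : 0 ≤ P + B)
    (cint_cont _ (wfa_cont2 c hc)).continuousOn (show P ∈ Set.Icc _ _ from ⟨by linarith, h1⟩)
  refine ⟨Δ, lt_of_le_of_ne hΔ.1 ?_, e⟩
  rintro rfl
  simp only at e
  linarith

lemma cap_upper (c : AddCircle T → ℝ) (hc : Continuous c) (hpos : ∀ y, 0 < c y) (P : ℝ)
    (hP : 0 < P) (Δ : ℝ) (hΔ : 0 < Δ) (hI : cint T (wfa c Δ) = P)
    (x : AddCircle T) (hx : ∀ n : ℤ, n ≠ 0 → n • x ≠ 0) (η : ℝ) (hη : 0 < η) :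
    ∀ᶠ y in 𝓝 x, ∀ R, IsAchievableRate (fun i => c (i • y)) P R →
      R ≤ cint T (wfr c Δ) / Real.log 2 + η := by
  have hl2 : 0 < Real.log 2 := Real.log_pos (by norm_num)
  have h1 := weyl_near x hx (wfr c Δ) (wfr_cont c hc hpos Δ) (η * Real.log 2 / 2) (by positivity)
  have h2 := weyl_near x hx (wfa c Δ) (wfa_cont c hc Δ) (η * Real.log 2 * Δ) (by positivity)
  filter_upwards [h1, h2] with y h1 h2 R hR
  have := conv (fun i => c (i • y)) (fun i => hpos _) Δ P (cint T (wfr c Δ) + η * Real.log 2) hΔ hP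
    (by
      filter_upwards [h1, h2] with l h1 h2
      have e0 : ∑ i ∈ Finset.range l, (Real.log (max Δ (c (i • y)) / c (i • y)) / 2 +
          (P - max (Δ - c (i • y)) 0) / (2 * Δ)) = ∑ i ∈ Finset.range l, wfr c Δ (i • y) +
          (∑ i ∈ Finset.range l, P - ∑ i ∈ Finset.range l, wfa c Δ (i • y)) / (2 * Δ) := by
        rw [Finset.sum_add_distrib, ← Finset.sum_sub_distrib, Finset.sum_div]; rfl
      rw [e0]
      have e1 := (abs_le.1 h1).2
      have e2 := (abs_le.1 h2).1
      rw [hI] at e2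
      have e3 : (∑ i ∈ Finset.range l, P - ∑ i ∈ Finset.range l, wfa c Δ (i • y)) / (2 * Δ)
          ≤ l * (η * Real.log 2) / 2 := by
        rw [div_le_iff₀ (by positivity)]
        simp only [Finset.sum_const, Finset.card_range, nsmul_eq_mul]
        nlinarith
      nlinarith) R hR
  rwa [add_div, mul_div_cancel_right₀ _ hl2.ne'] at this

lemma cap_lower (c : AddCircle T → ℝ) (hc : Continuous c) (hpos : ∀ y, 0 < c y) (P : ℝ)
    (hP : 0 < P) (Δ : ℝ) (hΔ : 0 < Δ) (hI : cint T (wfa c Δ) = P)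
    (x : AddCircle T) (hx : ∀ n : ℤ, n ≠ 0 → n • x ≠ 0) (η : ℝ) (hη : 0 < η) :
    ∀ᶠ y in 𝓝 x, IsAchievableRate (fun i => c (i • y)) P
      (cint T (wfr c Δ) / Real.log 2 - η) := by
  have hl2 : 0 < Real.log 2 := Real.log_pos (by norm_num)
  have hcr := cint_cont _ (wfr_cont2 c hc hpos)
  have hev : ∀ᶠ Δ' in 𝓝[<] Δ, cint T (wfr c Δ) - η * Real.log 2 / 2 < cint T (wfr c Δ') :=
    (hcr.tendsto Δ).mono_left nhdsWithin_le_nhds |>.eventually (lt_mem_nhds (by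
      have : 0 < η * Real.log 2 / 2 := by positivity
      linarith))
  have hev2 : ∀ᶠ Δ' in 𝓝[<] Δ, Δ' ∈ Set.Ioo 0 Δ := Ioo_mem_nhdsLT hΔ
  obtain ⟨Δ', hr, h0, hlt⟩ := (hev.and hev2).exists
  have hIa : cint T (wfa c Δ') < P := by
    have h1 : cint T (wfa c Δ') ≤ cint T (fun y => Δ' / Δ * wfa c Δ y) := by
      refine cint_mono _ _ (wfa_cont c hc _) (by have := wfa_cont c hc Δ; fun_prop) fun y => ?_
      unfold wfa
      rcases le_total Δ' (c y) with h | h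
      · rw [max_eq_right (by linarith)]
        exact mul_nonneg (by positivity) (le_max_right _ _)
      · rw [max_eq_left (by linarith), max_eq_left (by linarith), mul_sub,
          div_mul_cancel₀ _ hΔ.ne']
        have : Δ' / Δ * c y ≤ 1 * c y := by
          refine mul_le_mul_of_nonneg_right ?_ (hpos y).le
          rw [div_le_one hΔ]; exact hlt.le
        linarith
    have h2 : cint T (fun y => Δ' / Δ * wfa c Δ y) = Δ' / Δ * P := by
      rw [← hI]; exact integral_const_mul _ _
    have : Δ' / Δ < 1 := (div_lt_one hΔ).2 hlt
    nlinarith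
  set A := (cint T (wfa c Δ') + P) / 2 with hA
  have h1 := weyl_near x hx (wfr c Δ') (wfr_cont c hc hpos Δ') (η * Real.log 2 / 2) (by positivity)
  have h2 := weyl_near x hx (wfa c Δ') (wfa_cont c hc Δ') ((P - cint T (wfa c Δ')) / 2)
    (by linarith)
  filter_upwards [h1, h2] with y h1 h2
  have := ach (fun i => c (i • y)) (fun i => wfa c Δ' (i • y)) (fun i => hpos _)
    (fun i => le_max_right _ _) Δ' (fun i => max_le (by linarith [hpos (i • y)]) h0.le) P A
    (cint T (wfr c Δ) - η * Real.log 2) (by rw [hA]; linarith) (by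
      filter_upwards [h2] with l h2
      have := (abs_le.1 h2).2
      rw [hA]; nlinarith) (by
      filter_upwards [h1] with l h1
      have h3 := (abs_le.1 h1).1
      have e : ∑ i ∈ Finset.range l, Real.log ((wfa c Δ' (i • y) + c (i • y)) / c (i • y)) / 2
        = ∑ i ∈ Finset.range l, wfr c Δ' (i • y) := by
        refine Finset.sum_congr rfl fun i _ => ?_
        unfold wfr wfa
        rw [← max_add_add_right]; simp
      rw [e]
      have hl : (0:ℝ) ≤ l := Nat.cast_nonneg l
      nlinarith) hP
  rwa [sub_div, mul_div_cancel_right₀ _ hl2.ne'] at this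

theorem cap_tendsto (c : AddCircle T → ℝ) (hc : Continuous c) (hpos : ∀ y, 0 < c y) (P : ℝ)
    (hP : 0 < P) (Δ : ℝ) (hΔ : 0 < Δ) (hI : cint T (wfa c Δ) = P)
    (x : AddCircle T) (hx : ∀ n : ℤ, n ≠ 0 → n • x ≠ 0) :
    Tendsto (fun y => capacity (fun i => c (i • y)) P) (𝓝 x)
      (𝓝 (cint T (wfr c Δ) / Real.log 2)) := by
  rw [Metric.tendsto_nhds]
  intro η hη
  filter_upwards [cap_upper c hc hpos P hP Δ hΔ hI x hx (η / 2) (by positivity),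
    cap_lower c hc hpos P hP Δ hΔ hI x hx (η / 2) (by positivity)] with y h1 h2
  have hu : capacity (fun i => c (i • y)) P ≤ cint T (wfr c Δ) / Real.log 2 + η / 2 :=
    csSup_le ⟨_, h2⟩ h1
  have hl : cint T (wfr c Δ) / Real.log 2 - η / 2 ≤ capacity (fun i => c (i • y)) P :=
    le_csSup ⟨_, h1⟩ h2
  rw [Real.dist_eq, abs_lt]
  constructor <;> linarith

end Cap

/-- running maximum of the power excess -/
noncomputable def excess (a : ℕ → ℝ) (P : ℝ) : ℕ → ℝ
  | 0 => 0
  | k + 1 => max (excess a P k) (∑ i ∈ Finset.range (k + 1), a (i + 1) - (k + 1 : ℕ) * P)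

lemma excess_ge (a : ℕ → ℝ) (P : ℝ) (k : ℕ) :
    ∑ i ∈ Finset.range k, a (i + 1) - k * P ≤ excess a P k := by
  cases k with
  | zero => simp [excess]
  | succ k => exact le_max_right _ _

lemma excess_nonneg (a : ℕ → ℝ) (P : ℝ) (k : ℕ) : 0 ≤ excess a P k := by
  induction k with
  | zero => simp [excess]
  | succ k ih => exact le_max_of_le_left ih

lemma pow_adjust (a : ℕ → ℝ) (ha : ∀ i, 0 ≤ a i) (P : ℝ) (hP : 0 < P)
    (hlim : ∀ η > 0, ∀ᶠ k : ℕ in atTop, ∑ i ∈ Finset.range k, a (i + 1) ≤ k * (P + η)) :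
    ∃ s : ℕ → ℝ, (∀ i, 0 ≤ s i) ∧ (∀ i, s i ≤ a i) ∧
      (∀ k : ℕ, ∑ i ∈ Finset.range k, s (i + 1) ≤ k * P) ∧
      ∀ η > 0, ∀ᶠ k : ℕ in atTop, ∑ i ∈ Finset.range k, (a (i + 1) - s (i + 1)) ≤ k * η := by
  refine ⟨fun i => match i with
    | 0 => 0
    | k + 1 => a (k + 1) - (excess a P (k + 1) - excess a P k), ?_, ?_, ?_, ?_⟩
  · rintro (_ | k)
    · simp
    · have h1 := excess_ge a P k
      have h2 := ha (k + 1)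
      simp only [excess]
      rw [Finset.sum_range_succ]
      have : max (excess a P k) (∑ i ∈ Finset.range k, a (i + 1) + a (k + 1) - ↑(k + 1) * P) ≤
          excess a P k + a (k + 1) := by
        refine max_le (by linarith) ?_
        push_cast
        linarith
      linarith
  · rintro (_ | k)
    · exact ha 0
    · have : excess a P k ≤ excess a P (k + 1) := le_max_left _ _
      simp only
      linarith
  · intro k
    have h1 := excess_ge a P k
    simp only [Finset.sum_sub_distrib]
    have h2 := Finset.sum_range_sub (excess a P) k
    rw [Finset.sum_sub_distrib] at h2
    rw [h2]
    have : excess a P 0 = 0 := rfl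
    linarith
  · intro η hη
    obtain ⟨K, hK⟩ := eventually_atTop.1 (hlim (η / 2) (by positivity))
    have hb : ∀ k, K ≤ k → excess a P k ≤ excess a P K + k * (η / 2) := by
      intro k hk
      induction k, hk using Nat.le_induction with
      | base => have : 0 ≤ (K:ℝ) * (η / 2) := by positivity
                linarith
      | succ k hk ih =>
        refine max_le (ih.trans ?_) ?_
        · push_cast; linarith
        · have := hK (k + 1) (by omega)
          have := excess_nonneg a P K
          linarith
    have hev : ∀ᶠ k : ℕ in atTop, excess a P K ≤ k * (η / 2) :=
      (tendsto_natCast_atTop_atTop.atTop_mul_const (by positivity : 0 < η / 2)).eventually_ge_atTop _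
    filter_upwards [hev, eventually_ge_atTop K] with k h1 h2
    have h3 := hb k h2
    simp only [sub_sub_cancel]
    rw [Finset.sum_range_sub (excess a P) k]
    have : excess a P 0 = 0 := rfl
    linarith

lemma pliminf_eq (sX sW : ℕ → ℝ) (hX : ∀ i, 0 ≤ sX i) (hW : ∀ i, 0 < sW i) (L : ℝ)
    (hL : ∀ η > 0, ∀ᶠ k : ℕ in atTop,
      |∑ i ∈ Finset.range k, Real.log ((sX (i + 1) + sW (i + 1)) / sW (i + 1)) / 2 - k * L| ≤ k * η) :
    pliminfInfoDens sX sW = L / Real.log 2 := by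
  have hl2 : 0 < Real.log 2 := Real.log_pos (by norm_num)
  -- deviation probability
  have hdev : ∀ η > 0, Tendsto (fun k : ℕ => ((inputNoiseMeasure sX sW k)
      {xw | η ≤ |infoDensRate sX sW k xw.1 xw.2 - L / Real.log 2|}).toReal) atTop (𝓝 0) := by
    intro η hη
    set c := η * Real.log 2 / 2 with hc
    have hcpos : 0 < c := by positivity
    have hz : Tendsto (fun k : ℕ => 2 * gaussK / c ^ 2 * ((k : ℝ)⁻¹)) atTop (𝓝 0) := by
      have : Tendsto (fun k : ℕ => ((k : ℝ)⁻¹)) atTop (𝓝 0) :=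
        tendsto_inv_atTop_zero.comp tendsto_natCast_atTop_atTop
      simpa using this.const_mul (2 * gaussK / c ^ 2)
    refine squeeze_zero' (Eventually.of_forall fun k => ENNReal.toReal_nonneg) ?_ hz
    filter_upwards [hL c hcpos, eventually_gt_atTop 0] with k hk hk0
    have hkr : (0:ℝ) < k := by exact_mod_cast hk0
    have h := info_conc (fun i : Fin k => sX ((i : ℕ) + 1)) (fun i : Fin k => sW ((i : ℕ) + 1))
      (fun i => hX _) (fun i => hW _) (k * c) (by positivity)
    have hgk := gaussK_nonneg
    have h2 : (inputNoiseMeasure sX sW k)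
      {xw | η ≤ |infoDensRate sX sW k xw.1 xw.2 - L / Real.log 2|} ≤
        ENNReal.ofReal (2 * gaussK / c ^ 2 * ((k : ℝ)⁻¹)) := by
      refine le_trans (measure_mono ?_) (h.trans (le_of_eq ?_))
      · intro xw hxw
        have hxw' : η ≤ |infoDensRate sX sW k xw.1 xw.2 - L / Real.log 2| := hxw
        rw [Set.mem_ofPred_eq]
        rw [← Fin.sum_univ_eq_sum_range
          (fun i => Real.log ((sX (i + 1) + sW (i + 1)) / sW (i + 1)) / 2) k] at hk
        have e : infoDensRate sX sW k xw.1 xw.2 = (∑ i : Fin k, idens (sX ((i : ℕ) + 1) +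
            sW ((i : ℕ) + 1)) (sW ((i : ℕ) + 1)) (xw.1 i) (xw.1 i + xw.2 i)) / (k * Real.log 2) := by
          unfold infoDensRate
          rw [Finset.sum_congr rfl fun i _ => logb_gpdf _ _ (xw.1 i) (xw.2 i)
            (add_pos_of_nonneg_of_pos (hX _) (hW _)) (hW _), ← Finset.sum_div]
          field_simp
        rw [e] at hxw'
        set A := ∑ i : Fin k, idens (sX ((i : ℕ) + 1) +
            sW ((i : ℕ) + 1)) (sW ((i : ℕ) + 1)) (xw.1 i) (xw.1 i + xw.2 i)
        set B := ∑ i : Fin k, Real.log ((sX ((i:ℕ) + 1) + sW ((i:ℕ) + 1)) / sW ((i:ℕ) + 1)) / 2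
        have e2 : A / (k * Real.log 2) - L / Real.log 2 = (A - k * L) / (k * Real.log 2) := by
          field_simp
        rw [e2, abs_div, abs_of_pos (by positivity : 0 < (k:ℝ) * Real.log 2),
          le_div_iff₀ (by positivity)] at hxw'
        have := abs_sub_le A B (k * L)
        have e3 : η * (k * Real.log 2) = 2 * (k * c) := by rw [hc]; ring
        linarith
      · congr 1
        rw [Fintype.card_fin]
        field_simp
    exact ENNReal.toReal_le_of_le_ofReal (by positivity) h2
  have hprob : ∀ k, IsProbabilityMeasure (inputNoiseMeasure sX sW k) := by
    intro k; unfold inputNoiseMeasure; infer_instance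
  have hlow : ∀ α, α < L / Real.log 2 → Tendsto
    (fun k => ((inputNoiseMeasure sX sW k)
      {xw | infoDensRate sX sW k xw.1 xw.2 < α}).toReal) atTop (𝓝 0) := by
    intro α hα
    refine squeeze_zero (fun k => ENNReal.toReal_nonneg) (fun k => ?_)
      (hdev (L / Real.log 2 - α) (by linarith))
    have := hprob k
    refine ENNReal.toReal_mono (measure_ne_top _ _) (measure_mono fun xw h => ?_)
    have h' : infoDensRate sX sW k xw.1 xw.2 < α := h
    rw [Set.mem_ofPred_eq]
    rw [abs_sub_comm]
    exact le_trans (by linarith) (le_abs_self _)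
  have hhigh : ∀ α, Tendsto
    (fun k => ((inputNoiseMeasure sX sW k)
      {xw | infoDensRate sX sW k xw.1 xw.2 < α}).toReal) atTop (𝓝 0) → α ≤ L / Real.log 2 := by
    intro α h
    by_contra hα
    have hα' := not_le.1 hα
    have hs := h.add (hdev (α - L / Real.log 2) (by linarith))
    rw [add_zero] at hs
    have : (1:ℝ) ≤ 0 := by
      refine ge_of_tendsto' hs fun k => ?_
      have := hprob k
      rw [← ENNReal.toReal_add (measure_ne_top _ _) (measure_ne_top _ _)]
      have h1 : (1 : ℝ≥0∞) ≤ (inputNoiseMeasure sX sW k) {xw | infoDensRate sX sW k xw.1 xw.2 < α} +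
          (inputNoiseMeasure sX sW k)
            {xw | α - L / Real.log 2 ≤ |infoDensRate sX sW k xw.1 xw.2 - L / Real.log 2|} := by
        rw [← measure_univ (μ := inputNoiseMeasure sX sW k)]
        refine (measure_mono ?_).trans (measure_union_le _ _)
        intro xw _
        by_cases hh : infoDensRate sX sW k xw.1 xw.2 < α
        · exact Or.inl hh
        · right
          rw [Set.mem_ofPred_eq]
          exact le_trans (by linarith) (le_abs_self _)
      have := ENNReal.toReal_mono (by finiteness) h1
      simpa using this
    linarith
  unfold pliminfInfoDens
  refine le_antisymm (csSup_le ⟨L / Real.log 2 - 1, hlow _ (by linarith)⟩ hhigh) ?_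
  refine le_of_forall_lt fun α hα => ?_
  obtain ⟨β, h1, h2⟩ := exists_between hα
  exact h1.trans_le (le_csSup ⟨_, hhigh⟩ (hlow β h2))

lemma weyl_shift {T : ℝ} [hT : Fact (0 < T)] (x : AddCircle T)
    (hx : ∀ n : ℤ, n ≠ 0 → n • x ≠ 0) (g : AddCircle T → ℝ)
    (hg : Continuous g) (η : ℝ) (hη : 0 < η) :
    ∀ᶠ l : ℕ in atTop,
      |∑ i ∈ Finset.range l, g ((i + 1) • x) - l * cint T g| ≤ l * η := by
  have h := (weyl_near x hx g hg (η / 2) (by positivity)).self_of_nhds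
  have h1 := (tendsto_add_atTop_nat 1).eventually h
  have hev : ∀ᶠ k : ℕ in atTop, |cint T g - g (0 • x)| + η / 2 ≤ k * (η / 2) :=
      (tendsto_natCast_atTop_atTop.atTop_mul_const (by positivity : 0 < η / 2)).eventually_ge_atTop _
  filter_upwards [h1, hev] with l h1 h2
  rw [Finset.sum_range_succ'] at h1
  have e : ∑ i ∈ Finset.range l, g ((i + 1) • x) - l * cint T g =
    (∑ i ∈ Finset.range l, g ((i + 1) • x) + g (0 • x) - ↑(l + 1) * cint T g) +
      (cint T g - g (0 • x)) := by push_cast; ring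
  rw [e]
  refine (abs_add_le _ _).trans ?_
  push_cast at h1 ⊢
  linarith

theorem gauss_opt {T : ℝ} [hT : Fact (0 < T)] (c : AddCircle T → ℝ) (hc : Continuous c)
    (hpos : ∀ y, 0 < c y) (P : ℝ)
    (hP : 0 < P) (Δ : ℝ) (hI : cint T (wfa c Δ) = P)
    (x : AddCircle T) (hx : ∀ n : ℤ, n ≠ 0 → n • x ≠ 0) :
    ∃ sX : ℕ → ℝ, (∀ i, 0 ≤ sX i) ∧
      (∀ k : ℕ, ∑ i ∈ Finset.range k, sX (i + 1) ≤ k * P) ∧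
      pliminfInfoDens sX (fun i : ℕ => c (i • x)) = cint T (wfr c Δ) / Real.log 2 := by
  obtain ⟨y0, -, hy0⟩ := isCompact_univ.exists_isMinOn (f := c) Set.univ_nonempty hc.continuousOn
  set m := c y0 with hm
  have hmpos : 0 < m := hpos y0
  have hmle : ∀ y, m ≤ c y := fun y => hy0 (Set.mem_univ y)
  have hlim : ∀ η > 0, ∀ᶠ k : ℕ in atTop,
      ∑ i ∈ Finset.range k, wfa c Δ ((i + 1) • x) ≤ k * (P + η) := by
    intro η hη
    filter_upwards [weyl_shift x hx (wfa c Δ) (wfa_cont c hc Δ) η hη] with k hk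
    have := (abs_le.1 hk).2
    rw [hI] at this
    linarith
  obtain ⟨s, hs0, hsa, hsP, hsl⟩ := pow_adjust (fun i => wfa c Δ (i • x))
    (fun i => le_max_right _ _) P hP hlim
  refine ⟨s, hs0, hsP, pliminf_eq s _ hs0 (fun i => hpos _) _ ?_⟩
  intro η hη
  filter_upwards [weyl_shift x hx (wfr c Δ) (wfr_cont c hc hpos Δ) (η / 2) (by positivity),
    hsl (η * m) (by positivity)] with k h1 h2
  have hd : ∀ i : ℕ, 0 ≤ wfr c Δ (i • x) - Real.log ((s i + c (i • x)) / c (i • x)) / 2 ∧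
      wfr c Δ (i • x) - Real.log ((s i + c (i • x)) / c (i • x)) / 2 ≤
        (wfa c Δ (i • x) - s i) / (2 * m) := by
    intro i
    have hcp := hpos (i • x)
    have e : wfr c Δ (i • x) = Real.log ((wfa c Δ (i • x) + c (i • x)) / c (i • x)) / 2 := by
      unfold wfr wfa
      rw [← max_add_add_right]; simp
    have h3 := hsa i
    have h4 := hs0 i
    have h5 : 0 < s i + c (i • x) := by linarith
    have h6 : 0 < wfa c Δ (i • x) + c (i • x) := by linarith
    rw [e, Real.log_div h6.ne' hcp.ne', Real.log_div h5.ne' hcp.ne']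
    have h7 := Real.log_le_log h5 (by linarith : s i + c (i • x) ≤ wfa c Δ (i • x) + c (i • x))
    refine ⟨by linarith, ?_⟩
    have h8 := Real.log_le_sub_one_of_pos (div_pos h6 h5)
    rw [Real.log_div h6.ne' h5.ne'] at h8
    have h9 : (wfa c Δ (i • x) + c (i • x)) / (s i + c (i • x)) - 1 =
      (wfa c Δ (i • x) - s i) / (s i + c (i • x)) := by field_simp; ring
    have h10 : (wfa c Δ (i • x) - s i) / (s i + c (i • x)) ≤ (wfa c Δ (i • x) - s i) / m :=
      div_le_div_of_nonneg_left (by linarith) hmpos (by linarith [hmle (i • x)])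
    have h11 : (wfa c Δ (i • x) - s i) / (2 * m) = (wfa c Δ (i • x) - s i) / m / 2 := by
      field_simp
    rw [h11]; linarith
  have hlo := Finset.sum_nonneg fun i (_ : i ∈ Finset.range k) => (hd (i + 1)).1
  have hhi := Finset.sum_le_sum fun i (_ : i ∈ Finset.range k) => (hd (i + 1)).2
  rw [Finset.sum_sub_distrib] at hlo hhi
  have h12 : (∑ i ∈ Finset.range k, (wfa c Δ ((i + 1) • x) - s (i + 1))) / (2 * m) ≤ k * (η / 2) := by
    rw [div_le_iff₀ (by positivity)]
    linarith
  rw [Finset.sum_div] at h12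
  have h13 := abs_le.1 h1
  rw [abs_le]
  have hk0 : (0:ℝ) ≤ k * η := by positivity
  constructor <;> linarith

lemma floor_lim (ε : ℝ) :
    Tendsto (fun n : ℕ => (⌊(n : ℝ) * ε⌋ : ℝ) / (n : ℝ)) atTop (𝓝 ε) := by
  have h1 : Tendsto (fun n : ℕ => ε - (n : ℝ)⁻¹) atTop (𝓝 ε) := by
    have : Tendsto (fun k : ℕ => ((k : ℝ)⁻¹)) atTop (𝓝 0) :=
      tendsto_inv_atTop_zero.comp tendsto_natCast_atTop_atTop
    simpa using tendsto_const_nhds.sub this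
  refine tendsto_of_tendsto_of_tendsto_of_le_of_le' h1 tendsto_const_nhds ?_ ?_
  · filter_upwards [eventually_gt_atTop 0] with n hn
    have hn' : (0:ℝ) < n := by exact_mod_cast hn
    rw [le_div_iff₀ hn', sub_mul, inv_mul_cancel₀ hn'.ne']
    linarith [Int.sub_one_lt_floor ((n:ℝ) * ε)]
  · filter_upwards [eventually_gt_atTop 0] with n hn
    have hn' : (0:ℝ) < n := by exact_mod_cast hn
    rw [div_le_iff₀ hn']
    linarith [Int.floor_le ((n:ℝ) * ε)]

theorem stmt8_aux (C : ℝ → ℝ) (T_c : ℝ) (hT : 0 < T_c)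
    (hC_cont : Continuous C) (hC_pos : ∀ t, 0 < C t)
    (hC_per : ∀ t, C (t + T_c) = C t)
    (p : ℕ) (hp : 0 < p) (ε : ℝ) (hε0 : 0 < ε) (hirr : Irrational ε)
    (P : ℝ) (hP : 0 < P) :
    capacity (fun i : ℕ => C ((i : ℝ) * T_c / ((p : ℝ) + ε))) P =
      Filter.liminf (fun n : ℕ =>
        capacity (fun i : ℕ =>
          C ((i : ℝ) * T_c / ((p : ℝ) + (⌊(n : ℝ) * ε⌋ : ℝ) / (n : ℝ)))) P) atTop ∧
    ∃ sX : ℕ → ℝ, (∀ i, 0 ≤ sX i) ∧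
      (∀ k : ℕ, 0 < k → (1 / (k : ℝ)) * ∑ i ∈ Finset.range k, sX (i + 1) ≤ P) ∧
      pliminfInfoDens sX (fun i : ℕ => C ((i : ℝ) * T_c / ((p : ℝ) + ε))) =
        capacity (fun i : ℕ => C ((i : ℝ) * T_c / ((p : ℝ) + ε))) P := by
  have : Fact (0 < T_c) := ⟨hT⟩
  have hper : Function.Periodic C T_c := hC_per
  set c : AddCircle T_c → ℝ := hper.lift with hcdef
  have hcc : ∀ t : ℝ, c (t : AddCircle T_c) = C t := fun t => hper.lift_coe t
  have hc : Continuous c := by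
    refine (QuotientAddGroup.isQuotientMap_mk (N := AddSubgroup.zmultiples T_c)).continuous_iff.2 ?_
    exact hC_cont
  have hpos : ∀ y, 0 < c y := by
    intro y
    induction y using QuotientAddGroup.induction_on with
    | H t => exact (hcc t).symm ▸ hC_pos t
  have hrew : ∀ q : ℝ, (fun i : ℕ => C ((i : ℝ) * T_c / q)) =
      fun i : ℕ => c (i • ((T_c / q : ℝ) : AddCircle T_c)) := by
    intro q; funext i
    rw [← AddCircle.coe_nsmul, hcc, nsmul_eq_mul, mul_div_assoc]
  have hp' : (0:ℝ) < p := by exact_mod_cast hp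
  have hpe : (0:ℝ) < p + ε := by linarith
  set x : AddCircle T_c := ((T_c / (p + ε) : ℝ) : AddCircle T_c) with hxdef
  have hx : ∀ n : ℤ, n ≠ 0 → n • x ≠ 0 := by
    intro n hn h
    rw [hxdef, ← AddCircle.coe_zsmul, AddCircle.coe_eq_zero_iff] at h
    obtain ⟨k, hk⟩ := h
    simp only [zsmul_eq_mul] at hk
    have hk' : (k : ℝ) * (p + ε) = n := by
      field_simp at hk
      linarith
    have hk0 : k ≠ 0 := by
      rintro rfl
      simp at hk'
      exact hn (by exact_mod_cast hk'.symm)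
    have hirr2 : Irrational ((k : ℝ) * ((p:ℝ) + ε)) := (hirr.natCast_add p).intCast_mul hk0
    exact hirr2.ne_int n hk'
  obtain ⟨Δ, hΔ, hI⟩ := level_exists c hc hpos P hP
  have hten := cap_tendsto c hc hpos P hP Δ hΔ hI x hx
  have hcap : capacity (fun i : ℕ => C ((i : ℝ) * T_c / ((p : ℝ) + ε))) P =
      cint T_c (wfr c Δ) / Real.log 2 := by
    rw [hrew]
    exact tendsto_nhds_unique (tendsto_pure_nhds (fun y => capacity (fun i => c (i • y)) P) x) (hten.mono_left (pure_le_nhds x))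
  have hseq : Tendsto (fun n : ℕ => ((T_c / ((p : ℝ) + (⌊(n : ℝ) * ε⌋ : ℝ) / (n : ℝ)) : ℝ) :
      AddCircle T_c)) atTop (𝓝 x) := by
    refine ((AddCircle.continuous_mk' T_c).tendsto _).comp ?_
    refine tendsto_const_nhds.div (tendsto_const_nhds.add ?_) hpe.ne'
    exact floor_lim ε
  refine ⟨?_, ?_⟩
  · rw [hcap]
    have h2 := (hten.comp hseq).liminf_eq
    rw [← h2]
    congr 1
    funext n
    simp only [Function.comp]
    rw [hrew]
  · obtain ⟨s, h1, h2, h3⟩ := gauss_opt c hc hpos P hP Δ hI x hx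
    refine ⟨s, h1, fun k hk => ?_, ?_⟩
    · have hk' : (0:ℝ) < k := by exact_mod_cast hk
      rw [one_div, inv_mul_le_iff₀ hk']
      exact h2 k
    · rw [hcap, hrew]; exact h3

/-- For irrational `ε ∈ (0,1)`, the capacity `C_ε` of the asynchronously
sampled channel `Y_ε[i] = X[i] + W_ε[i]` (noise variances `σ_ε²[i] = C(i·T_c/(p+ε))`) under the
average power constraint `P` equals `liminf_{n→∞} C_n`, where `C_n` is the capacity of the
synchronously sampled channel with noise variances `C(i·T_c/(p+ε_n))`, `ε_n = ⌊n·ε⌋/n`.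
Furthermore, Gaussian inputs are optimal: some memoryless zero-mean Gaussian input satisfying
the power constraint attains, as the limit-inferior in probability of its mutual information
density rates, the capacity `C_ε`. -/
theorem stmt8 (C : ℝ → ℝ) (T_c : ℝ) (hT : 0 < T_c)
    (hC_cont : Continuous C) (hC_pos : ∀ t, 0 < C t)
    (hC_per : ∀ t, C (t + T_c) = C t)
    (p : ℕ) (hp : 0 < p) (ε : ℝ) (hε0 : 0 < ε) (hε1 : ε < 1) (hirr : Irrational ε)
    (P : ℝ) (hP : 0 < P) :
    capacity (fun i : ℕ => C ((i : ℝ) * T_c / ((p : ℝ) + ε))) P =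
      Filter.liminf (fun n : ℕ =>
        capacity (fun i : ℕ =>
          C ((i : ℝ) * T_c / ((p : ℝ) + (⌊(n : ℝ) * ε⌋ : ℝ) / (n : ℝ)))) P) atTop ∧
    ∃ sX : ℕ → ℝ, (∀ i, 0 ≤ sX i) ∧
      (∀ k : ℕ, 0 < k → (1 / (k : ℝ)) * ∑ i ∈ Finset.range k, sX (i + 1) ≤ P) ∧
      pliminfInfoDens sX (fun i : ℕ => C ((i : ℝ) * T_c / ((p : ℝ) + ε))) =
        capacity (fun i : ℕ => C ((i : ℝ) * T_c / ((p : ℝ) + ε))) P := by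
  exact stmt8_aux C T_c hT hC_cont hC_pos hC_per p hp ε hε0 hirr P hP
end
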